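/- arXiv:2512.06229 — 2 statements merged into one kernel-verified Lean document; each statement's English description precedes it below -/
import Mathlib

section
/- Every forest F on n ≥ 7p − 3 vertices (p ≥ 3 prime) with no isolated vertices and fewer than 2(p−1) leaves contains p − 1 vertices t₁, …, t_{p−1}, each of degree exactly 2, such that no two of these vertices are adjacent and no two share a common neighbor. -/
open Finset

lemma sdt_unique {V : Type*} (F : SimpleGraph V) (hF : F.IsAcyclic) {r x y z : V}
    (hr : F.Reachable r x) (hy : F.Adj x y) (hz : F.Adj x z)
    (dy : F.dist r y ≤ F.dist r x) (dz : F.dist r z ≤ F.dist r x) : y = z := by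
  classical
  have key : ∀ y, F.Adj x y → F.dist r y ≤ F.dist r x →
      ∃ (q : F.Walk r y) (h : F.Adj y x), (q.concat h).IsPath := by
    intro y hy dy
    obtain ⟨q, hq, hl⟩ := (hr.trans hy.reachable).exists_path_of_dist
    refine ⟨q, hy.symm, hq.concat ?_ hy.symm⟩
    intro hx
    have h1 := SimpleGraph.Walk.length_takeUntil_lt_length hx hy.ne
    have h2 := F.dist_le (q.takeUntil x hx)
    omega
  obtain ⟨q, h, hq⟩ := key y hy dy
  obtain ⟨q', h', hq'⟩ := key z hz dz
  have := hF.path_unique ⟨_, hq⟩ ⟨_, hq'⟩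
  exact (SimpleGraph.Walk.concat_inj (Subtype.mk.inj this)).1

lemma sdt_center {V : Type*} (F : SimpleGraph V) (hF : F.IsAcyclic) (S : Finset V)
    (hS : S.Nonempty) : ∃ v ∈ S, ∃ u, (v = u ∨ F.Adj u v) ∧
      ∀ w ∈ S, (F.Adj v w ∨ ∃ x, F.Adj v x ∧ F.Adj w x) → w = u ∨ F.Adj u w := by
  classical
  obtain ⟨r, hr⟩ := hS
  obtain ⟨v, hv, hmax⟩ := (S.filter (fun v => F.Reachable r v)).exists_max_image (F.dist r)
    ⟨r, by simp [hr]⟩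
  simp only [mem_filter] at hv hmax
  have hx : ∀ w ∈ S, ∀ x, F.Adj v x → F.Adj w x → F.dist r v < F.dist r x → v = w := by
    intro w hw x h1 h2 h3
    have h4 := hmax w ⟨hw, (hv.2.trans h1.reachable).trans h2.symm.reachable⟩
    exact sdt_unique F hF (hv.2.trans h1.reachable) h1.symm h2.symm h3.le (by omega)
  by_cases hu : ∃ u, F.Adj v u ∧ F.dist r u ≤ F.dist r v
  · obtain ⟨u, hvu, du⟩ := hu
    refine ⟨v, hv.1, u, Or.inr hvu.symm, ?_⟩
    rintro w hw (h | ⟨x, h1, h2⟩)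
    · exact Or.inl (sdt_unique F hF hv.2 h hvu (hmax w ⟨hw, hv.2.trans h.reachable⟩) du)
    · by_cases h3 : F.dist r x ≤ F.dist r v
      · have := sdt_unique F hF hv.2 h1 hvu h3 du
        subst this
        exact Or.inr h2.symm
      · have := hx w hw x h1 h2 (by omega)
        subst this
        exact Or.inr hvu.symm
  · push Not at hu
    refine ⟨v, hv.1, v, Or.inl rfl, ?_⟩
    rintro w hw (h | ⟨x, h1, h2⟩)
    · exact Or.inr h
    · exact Or.inl (hx w hw x h1 h2 (hu x h1)).symm

lemma sdt_greedy {V : Type*} [DecidableEq V] (F : SimpleGraph V) (hF : F.IsAcyclic)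
    (S : Finset V) : ∃ T U : Finset V, T ⊆ S ∧ U.card ≤ T.card ∧
      (∀ s ∈ S, ∃ u ∈ U, s = u ∨ F.Adj u s) ∧
      (∀ a ∈ T, ∀ b ∈ T, a ≠ b → ¬ (F.Adj a b ∨ ∃ x, F.Adj a x ∧ F.Adj b x)) := by
  classical
  induction S using Finset.strongInduction with
  | H S ih =>
    rcases S.eq_empty_or_nonempty with rfl | hS
    · exact ⟨∅, ∅, by simp⟩
    obtain ⟨v, hv, u, hvu, hc⟩ := sdt_center F hF S hS
    obtain ⟨T, U, hT, hcard, hcov, hind⟩ := ih (S.filter fun w => ¬ (w = u ∨ F.Adj u w))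
      (Finset.filter_ssubset.2 ⟨v, hv, not_not_intro hvu⟩)
    have hT' : ∀ w ∈ T, w ∈ S ∧ ¬ (w = u ∨ F.Adj u w) := fun w hw => by
      simpa using hT hw
    have hvT : v ∉ T := fun h => (hT' v h).2 hvu
    refine ⟨insert v T, insert u U, ?_, ?_, ?_, ?_⟩
    · intro w hw
      rcases mem_insert.1 hw with rfl | hw
      · exact hv
      · exact (hT' w hw).1
    · rw [card_insert_of_notMem hvT]
      exact (card_insert_le _ _).trans (by omega)
    · intro s hs
      by_cases h : s = u ∨ F.Adj u s
      · exact ⟨u, by simp, h⟩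
      · obtain ⟨y, hy, h'⟩ := hcov s (mem_filter.2 ⟨hs, h⟩)
        exact ⟨y, mem_insert_of_mem hy, h'⟩
    · intro a ha b hb hab h
      rcases mem_insert.1 ha with rfl | haT
      · rcases mem_insert.1 hb with rfl | hb
        · exact hab rfl
        · exact (hT' b hb).2 (hc b (hT' b hb).1 h)
      · rcases mem_insert.1 hb with rfl | hb
        · refine (hT' a haT).2 (hc a (hT' a haT).1 ?_)
          rcases h with h | ⟨x, h1, h2⟩
          · exact Or.inl h.symm
          · exact Or.inr ⟨x, h2, h1⟩
        · exact hind a haT b hb hab h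

lemma sdt_edges {V : Type*} [Fintype V] [DecidableEq V] (F : SimpleGraph V) [DecidableRel F.Adj]
    (hF : F.IsAcyclic) [Nonempty V] : ∑ v, F.degree v ≤ 2 * Fintype.card V := by
  classical
  obtain ⟨T, hFT, -, hT⟩ :=
    SimpleGraph.connected_top.exists_isTree_le_of_le_of_isAcyclic (le_top : F ≤ ⊤) hF
  have h1 := hT.card_edgeFinset
  have h2 : F.edgeFinset.card ≤ T.edgeFinset.card :=
    card_le_card (SimpleGraph.edgeFinset_mono hFT)
  rw [F.sum_degrees_eq_twice_card_edges]
  omega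

/-- A large non-bushy forest contains `p − 1` degree-2 vertices that are pairwise
non-adjacent and share no common neighbor. -/
theorem select_degree_two_vertices (p : ℕ) (hp : p.Prime) (hp3 : 3 ≤ p)
    (V : Type*) [Fintype V] [DecidableEq V] (F : SimpleGraph V) [DecidableRel F.Adj]
    (hforest : F.IsAcyclic) (hiso : ∀ v, 0 < F.degree v)
    (hn : 7 * p - 3 ≤ Fintype.card V)
    (hleaves : (univ.filter fun v => F.degree v = 1).card < 2 * (p - 1)) :
    ∃ t : Fin (p - 1) ↪ V,
      (∀ i, F.degree (t i) = 2) ∧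
      (∀ i j, i ≠ j → ¬ F.Adj (t i) (t j)) ∧
      (∀ i j, i ≠ j → ∀ w : V, ¬ (F.Adj (t i) w ∧ F.Adj (t j) w)) := by

  classical
  obtain ⟨T, U, hT, hcard, hcov, hind⟩ :=
    sdt_greedy F hforest (univ.filter fun v => F.degree v = 2)
  have hbig : p - 1 ≤ T.card := by
    by_contra hlt
    have : Nonempty V := Fintype.card_pos_iff.1 (by omega)
    have hE := sdt_edges F hforest
    have h1 : (univ.filter fun v => F.degree v = 2).card
        ≤ ∑ u ∈ U, (3 + (F.degree u - 3)) := by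
      have hsub : (univ.filter fun v => F.degree v = 2) ⊆
          U.biUnion (fun u => (univ.filter fun v => F.degree v = 2) ∩
            insert u (F.neighborFinset u)) := by
        intro s hs
        obtain ⟨u, hu, h⟩ := hcov s hs
        refine mem_biUnion.2 ⟨u, hu, mem_inter.2 ⟨hs, ?_⟩⟩
        simpa using h
      refine (card_le_card hsub).trans (card_biUnion_le.trans (sum_le_sum ?_))
      intro u _
      by_cases hu : F.degree u ≤ 2
      · refine (card_le_card inter_subset_right).trans ((card_insert_le _ _).trans ?_)
        rw [F.card_neighborFinset_eq_degree]
        omega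
      · have hs : (univ.filter fun v => F.degree v = 2) ∩ insert u (F.neighborFinset u)
            ⊆ F.neighborFinset u := by
          intro w hw
          obtain ⟨hw1, hw2⟩ := mem_inter.1 hw
          rcases mem_insert.1 hw2 with rfl | h
          · have := (mem_filter.1 hw1).2
            omega
          · exact h
        refine (card_le_card hs).trans ?_
        rw [F.card_neighborFinset_eq_degree]
        omega
    have h2 : ∑ u ∈ U, (3 + (F.degree u - 3)) ≤ 3 * U.card + ∑ u, (F.degree u - 3) := by
      rw [sum_add_distrib, sum_const, smul_eq_mul, mul_comm]
      exact Nat.add_le_add_left (sum_le_sum_of_subset (subset_univ U)) _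
    have h3 : ∑ v, F.degree v + 2 * (univ.filter fun v => F.degree v = 1).card
        + (univ.filter fun v => F.degree v = 2).card
        = 3 * Fintype.card V + ∑ v, (F.degree v - 3) := by
      rw [card_filter, card_filter, mul_sum, ← sum_add_distrib, ← sum_add_distrib]
      have : 3 * Fintype.card V = ∑ _v : V, 3 := by simp [mul_comm]
      rw [this, ← sum_add_distrib]
      refine sum_congr rfl fun v _ => ?_
      have := hiso v
      split_ifs <;> omega
    omega
  obtain ⟨T', hT', hc⟩ := exists_subset_card_eq hbig
  let e : Fin (p - 1) ≃ T' := (T'.equivFinOfCardEq hc).symm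
  have hm : ∀ i, (e i : V) ∈ T := fun i => hT' (e i).2
  have hne : ∀ i j, i ≠ j → (e i : V) ≠ e j := fun i j hij h =>
    hij (e.injective (Subtype.ext h))
  refine ⟨e.toEmbedding.trans (Function.Embedding.subtype _), ?_, ?_, ?_⟩
  · intro i
    exact (mem_filter.1 (hT (hm i))).2
  · intro i j hij h
    exact hind _ (hm i) _ (hm j) (hne i j hij) (Or.inl h)
  · intro i j hij w h
    exact hind _ (hm i) _ (hm j) (hne i j hij) (Or.inr ⟨w, h⟩)
end

section
/- For every prime p, every forest F on n ≥ 3p² − 12p + 11 vertices with p | e(F) satisfies R(F, ℤ/pℤ) ≤ n + 9p − 12, where R(F, ℤ/pℤ) is the least N such that every edge-coloring χ : E(K_N) → ℤ/pℤ admits a copy of F with Σ_{e ∈ E(F)} χ(e) = 0. -/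
open Finset

/-- Every nonempty set of vertices of a finite forest contains a vertex with at most one
neighbour inside the set. -/
lemma zs_degen {V : Type*} [Fintype V] [DecidableEq V] (F : SimpleGraph V) [DecidableRel F.Adj]
    (hF : F.IsAcyclic) (S : Finset V) (hS : S.Nonempty) :
    ∃ v ∈ S, #{w ∈ S | F.Adj v w} ≤ 1 := by
  classical
  by_contra! hcon
  obtain ⟨v0, hv0⟩ := hS
  set H := F.induce (S : Set V) with hH
  have hHa : H.IsAcyclic := hF.induce _
  have hdeg : ∀ v : (S : Set V), 2 ≤ H.degree v := by
    intro v
    have h := hcon v.1 v.2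
    have : #{w ∈ S | F.Adj v.1 w} ≤ H.degree v := by
      rw [← SimpleGraph.card_neighborFinset_eq_degree]
      rw [← Finset.card_map (Function.Embedding.subtype _) (s := H.neighborFinset v)]
      apply Finset.card_le_card
      intro w hw
      simp only [Finset.mem_filter] at hw
      simp only [Finset.mem_map, SimpleGraph.mem_neighborFinset]
      exact ⟨⟨w, hw.1⟩, by simpa [hH] using hw.2, rfl⟩
    omega
  set c := H.connectedComponentMk ⟨v0, hv0⟩ with hc
  have hT : c.toSimpleGraph.IsTree := hHa.isTree_connectedComponent c
  have hdc : ∀ v : c, H.degree v.1 ≤ c.toSimpleGraph.degree v := by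
    intro v
    rw [← SimpleGraph.card_neighborFinset_eq_degree, ← SimpleGraph.card_neighborFinset_eq_degree]
    rw [← Finset.card_map (Function.Embedding.subtype _) (s := c.toSimpleGraph.neighborFinset v)]
    apply Finset.card_le_card
    intro w hw
    simp only [SimpleGraph.mem_neighborFinset] at hw
    simp only [Finset.mem_map, SimpleGraph.mem_neighborFinset]
    exact ⟨⟨w, c.mem_supp_of_adj_mem_supp v.2 hw⟩, hw, rfl⟩
  have hnt : Nontrivial c := by
    have h2 := hdeg ⟨v0, hv0⟩
    have : 0 < c.toSimpleGraph.degree ⟨⟨v0, hv0⟩, rfl⟩ := by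
      have := hdc ⟨⟨v0, hv0⟩, rfl⟩
      dsimp only at this
      omega
    rw [SimpleGraph.degree_pos_iff_exists_adj] at this
    obtain ⟨w, hw⟩ := this
    exact ⟨⟨_, _, hw.ne⟩⟩
  obtain ⟨v, hv⟩ := hT.exists_vert_degree_one_of_nontrivial
  have := hdeg v.1
  have := hdc v
  omega

/-- Degree sums drop by twice the degree when a vertex is erased. -/
lemma zs_degsum_erase {W : Type*} [DecidableEq W] (R : W → W → Prop) [DecidableRel R]
    (hsym : ∀ x y, R x y → R y x) (hirr : ∀ x, ¬ R x x) (S : Finset W) (v : W) (hv : v ∈ S) :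
    ∑ x ∈ S, #{y ∈ S | R x y}
      = ∑ x ∈ S.erase v, #{y ∈ S.erase v | R x y} + 2 * #{y ∈ S | R v y} := by
  rw [← Finset.add_sum_erase S _ hv]
  have h1 : ∀ x ∈ S.erase v, #{y ∈ S | R x y}
      = #{y ∈ S.erase v | R x y} + (if R v x then 1 else 0) := by
    intro x hx
    rw [← Finset.insert_erase hv, Finset.filter_insert, Finset.erase_insert (by simp)]
    by_cases h : R v x
    · rw [if_pos (hsym _ _ h), if_pos h, Finset.card_insert_of_notMem (by simp)]
    · rw [if_neg (fun h' => h (hsym _ _ h')), if_neg h]; rfl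
  rw [Finset.sum_congr rfl h1, Finset.sum_add_distrib]
  have h2 : ∑ x ∈ S.erase v, (if R v x then 1 else 0) = #{y ∈ S | R v y} := by
    rw [← Finset.card_filter]
    congr 1
    ext y
    simp only [Finset.mem_filter, Finset.mem_erase]
    constructor
    · rintro ⟨⟨_, h⟩, h'⟩; exact ⟨h, h'⟩
    · rintro ⟨h, h'⟩; exact ⟨⟨fun e => hirr v (e ▸ h'), h⟩, h'⟩
  rw [h2]; ring

lemma zs_forest_degsum {V : Type*} [Fintype V] [DecidableEq V] (F : SimpleGraph V)
    [DecidableRel F.Adj] (hF : F.IsAcyclic) (S : Finset V) (hS : S.Nonempty) :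
    ∑ x ∈ S, #{y ∈ S | F.Adj x y} + 2 ≤ 2 * #S := by
  induction hn : #S generalizing S with
  | zero => simp at hn; simp [hn] at hS
  | succ k ih =>
    obtain ⟨v, hv, hv1⟩ := zs_degen F hF S hS
    rw [zs_degsum_erase F.Adj (fun x y h => h.symm) (fun x => F.irrefl) S v hv]
    have hc : #(S.erase v) = k := by rw [Finset.card_erase_of_mem hv, hn]; rfl
    by_cases he : (S.erase v).Nonempty
    · have := ih _ he hc
      omega
    · rw [Finset.not_nonempty_iff_eq_empty] at he
      have hSv : S = {v} := by
        rw [← Finset.insert_erase hv, he]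
        simp
      rw [he]
      subst hSv
      simp [Finset.filter_singleton]

/-- A graph with large degree sum contains a subset with large minimum degree. -/
lemma zs_core {W : Type*} [DecidableEq W] (R : W → W → Prop) [DecidableRel R]
    (hsym : ∀ x y, R x y → R y x) (hirr : ∀ x, ¬ R x x) (d : ℕ) (S : Finset W)
    (hS : 2 * d * #S < ∑ x ∈ S, #{y ∈ S | R x y}) :
    ∃ A ⊆ S, A.Nonempty ∧ ∀ x ∈ A, d + 1 ≤ #{y ∈ A | R x y} := by
  induction hn : #S generalizing S with
  | zero => simp at hn; simp [hn] at hS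
  | succ k ih =>
    by_cases h : ∀ x ∈ S, d + 1 ≤ #{y ∈ S | R x y}
    · exact ⟨S, subset_rfl, Finset.card_pos.1 (by omega), h⟩
    · push Not at h
      obtain ⟨v, hv, hv1⟩ := h
      rw [zs_degsum_erase R hsym hirr S v hv] at hS
      have hc : #(S.erase v) = k := by rw [Finset.card_erase_of_mem hv, hn]; rfl
      obtain ⟨A, hA, h1, h2⟩ := ih (S.erase v) (by rw [hc]; rw [hn] at hS; nlinarith) hc
      exact ⟨A, hA.trans (Finset.erase_subset _ _), h1, h2⟩

/-- Greedy embedding of a forest. -/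
lemma zs_greedy {V W : Type*} [Fintype V] [DecidableEq V] [DecidableEq W] [Nonempty W]
    (F : SimpleGraph V) [DecidableRel F.Adj] (hF : F.IsAcyclic)
    (R : W → W → Prop) [DecidableRel R]
    (hsym : ∀ x y, R x y → R y x) (hirr : ∀ x, ¬ R x x) (A : Finset W) (S : Finset V)
    (hcard : #S ≤ #A) (hdeg : ∀ x ∈ A, #S ≤ #{y ∈ A | R x y} + 1) :
    ∃ f : V → W, Set.InjOn f S ∧ (∀ v ∈ S, f v ∈ A) ∧
      ∀ u ∈ S, ∀ v ∈ S, F.Adj u v → R (f u) (f v) := by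
  induction hn : #S generalizing S with
  | zero =>
    simp at hn; subst hn
    exact ⟨fun _ => Classical.arbitrary W, by simp, by simp, by simp⟩
  | succ k ih =>
    obtain ⟨v, hv, hv1⟩ := zs_degen F hF S (Finset.card_pos.1 (by omega))
    have hc : #(S.erase v) = k := by rw [Finset.card_erase_of_mem hv, hn]; rfl
    obtain ⟨f, hinj, hA, hR⟩ := ih (S.erase v) (by omega)
      (fun x hx => by have := hdeg x hx; omega) hc
    -- it suffices to find a new image
    suffices h : ∃ y ∈ A, (∀ u ∈ S.erase v, f u ≠ y) ∧
        ∀ u ∈ S.erase v, F.Adj v u → R (f u) y by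
      obtain ⟨y, hyA, hy1, hy2⟩ := h
      have hup : ∀ u ∈ S, u ≠ v → Function.update f v y u = f u := by
        intro u _ hne
        simp [Function.update_of_ne hne]
      have hupv : Function.update f v y v = y := by simp
      refine ⟨Function.update f v y, ?_, ?_, ?_⟩
      · intro a ha b hb hab
        have ha' : a ∈ S := ha
        have hb' : b ∈ S := hb
        by_cases h1 : a = v <;> by_cases h2 : b = v
        · rw [h1, h2]
        · subst h1; rw [hupv, hup b hb' h2] at hab
          exact absurd hab.symm (hy1 b (Finset.mem_erase.2 ⟨h2, hb'⟩))
        · subst h2; rw [hupv, hup a ha' h1] at hab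
          exact absurd hab (hy1 a (Finset.mem_erase.2 ⟨h1, ha'⟩))
        · rw [hup a ha' h1, hup b hb' h2] at hab
          exact hinj (by simp [h1, ha']) (by simp [h2, hb']) hab
      · intro u hu
        by_cases h1 : u = v
        · subst h1; rw [hupv]; exact hyA
        · rw [hup u hu h1]; exact hA u (Finset.mem_erase.2 ⟨h1, hu⟩)
      · intro a ha b hb hab
        by_cases h1 : a = v <;> by_cases h2 : b = v
        · subst h1; subst h2; exact absurd hab F.irrefl
        · subst h1; rw [hupv, hup b hb h2]
          exact hsym _ _ (hy2 b (Finset.mem_erase.2 ⟨h2, hb⟩) hab)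
        · subst h2; rw [hupv, hup a ha h1]
          exact hy2 a (Finset.mem_erase.2 ⟨h1, ha⟩) hab.symm
        · rw [hup a ha h1, hup b hb h2]
          exact hR a (Finset.mem_erase.2 ⟨h1, ha⟩) b (Finset.mem_erase.2 ⟨h2, hb⟩) hab
    by_cases hnb : ∃ u ∈ S.erase v, F.Adj v u
    · obtain ⟨u, hu, huv⟩ := hnb
      have huS : u ∈ S := Finset.mem_of_mem_erase hu
      have huniq : ∀ u' ∈ S.erase v, F.Adj v u' → u' = u := by
        intro u' hu' h'
        exact Finset.card_le_one.1 hv1 u' (by simp [h', Finset.mem_of_mem_erase hu'])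
          u (by simp [huv, huS])
      have hlt : #(((S.erase v).erase u).image f) < #{y ∈ A | R (f u) y} := by
        have h1 := Finset.card_image_le (s := (S.erase v).erase u) (f := f)
        have h2 := Finset.card_erase_of_mem hu
        have h3 := hdeg (f u) (hA u hu)
        have h4 : 0 < #(S.erase v) := Finset.card_pos.2 ⟨u, hu⟩
        omega
      obtain ⟨y, hy, hy'⟩ := Finset.exists_mem_notMem_of_card_lt_card hlt
      simp only [Finset.mem_filter] at hy
      refine ⟨y, hy.1, ?_, ?_⟩
      · intro u' hu' he
        by_cases h : u' = u
        · subst h; rw [← he] at hy; exact hirr _ hy.2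
        · exact hy' (Finset.mem_image.2 ⟨u', Finset.mem_erase.2 ⟨h, hu'⟩, he⟩)
      · intro u' hu' h'
        rw [huniq u' hu' h']; exact hy.2
    · push Not at hnb
      have hlt : #((S.erase v).image f) < #A := by
        have h1 := Finset.card_image_le (s := S.erase v) (f := f)
        omega
      obtain ⟨y, hy, hy'⟩ := Finset.exists_mem_notMem_of_card_lt_card hlt
      exact ⟨y, hy, fun u hu he => hy' (Finset.mem_image.2 ⟨u, hu, he⟩),
        fun u hu h => absurd h (hnb u hu)⟩

open scoped Pointwise in
/-- Subset-sum form of Cauchy-Davenport for two-element choices. -/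
lemma zs_cd (p : ℕ) [Fact p.Prime] {V : Type*} [DecidableEq V] (I : Finset V) (a b : V → ZMod p)
    (hab : ∀ v ∈ I, a v ≠ b v) :
    ∃ T : Finset (ZMod p), min p (#I + 1) ≤ #T ∧
      ∀ t ∈ T, ∃ s : V → Bool, ∑ v ∈ I, (if s v then b v else a v) = t := by
  classical
  induction I using Finset.induction_on with
  | empty =>
    refine ⟨{0}, by simp, ?_⟩
    intro t ht
    exact ⟨fun _ => true, by rw [Finset.mem_singleton] at ht; simp [ht]⟩
  | insert v I hv ih =>
    obtain ⟨T, hT, hs⟩ := ih (fun w hw => hab w (Finset.mem_insert_of_mem hw))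
    have hne := hab v (Finset.mem_insert_self _ _)
    have hTne : T.Nonempty := by
      rw [← Finset.card_pos]
      have : 0 < p := (Fact.out : p.Prime).pos
      omega
    refine ⟨T + ({a v, b v} : Finset (ZMod p)), ?_, ?_⟩
    · have := ZMod.cauchy_davenport (Fact.out : p.Prime) hTne
        (t := {a v, b v}) ⟨a v, by simp⟩
      rw [Finset.card_pair hne] at this
      rw [Finset.card_insert_of_notMem hv]
      omega
    · intro t ht
      obtain ⟨t1, ht1, t2, ht2, rfl⟩ := Finset.mem_add.1 ht
      obtain ⟨s, hs1⟩ := hs t1 ht1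
      simp only [Finset.mem_insert, Finset.mem_singleton] at ht2
      have key : ∀ c : Bool, ∑ w ∈ I, (if Function.update s v c w then b w else a w) = t1 := by
        intro c
        rw [← hs1]
        apply Finset.sum_congr rfl
        intro w hw
        have hwv : w ≠ v := fun h => hv (h ▸ hw)
        rw [Function.update_of_ne hwv]
      rcases ht2 with rfl | rfl
      · refine ⟨Function.update s v false, ?_⟩
        rw [Finset.sum_insert hv, key]
        simp [add_comm]
      · refine ⟨Function.update s v true, ?_⟩
        rw [Finset.sum_insert hv, key]
        simp [add_comm]

/-- Injection between finsets given by a globally defined function. -/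
lemma zs_inj {V W : Type*} [Nonempty W] (X : Finset V) (Y : Finset W) (h : #X ≤ #Y) :
    ∃ f : V → W, Set.InjOn f X ∧ ∀ v ∈ X, f v ∈ Y := by
  classical
  have : Nonempty (X ↪ Y) := Function.Embedding.nonempty_of_card_le (by simpa using h)
  obtain ⟨g⟩ := this
  refine ⟨fun v => if hv : v ∈ X then (g ⟨v, hv⟩ : W) else Classical.arbitrary W, ?_, ?_⟩
  · intro a ha b hb hab
    have ha' : a ∈ X := ha
    have hb' : b ∈ X := hb
    simp only [ha', hb', dif_pos] at hab
    have := g.injective (Subtype.ext hab)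
    simpa using this
  · intro v hv
    simp [hv]

/-- Extend a partial injection, avoiding a given set. -/
lemma zs_extend {V W : Type*} [Fintype V] [DecidableEq V] [Fintype W] [DecidableEq W]
    (f : V → W) (S : Finset V) (B : Finset W) (hinj : Set.InjOn f S) (hfB : ∀ v ∈ S, f v ∈ B)
    (hcard : #B + Fintype.card V ≤ Fintype.card W + #S) :
    ∃ g : V → W, Function.Injective g ∧ (∀ v ∈ S, g v = f v) ∧ ∀ v ∉ S, g v ∉ B := by
  by_cases hV : Nonempty V
  swap
  · exact ⟨f, fun a => (hV ⟨a⟩).elim, fun _ _ => rfl, fun v => (hV ⟨v⟩).elim⟩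
  have : Nonempty W := hV.map f
  obtain ⟨h, hi, hm⟩ := zs_inj (Finset.univ \ S) (Finset.univ \ B) (by
    rw [Finset.card_sdiff_of_subset (Finset.subset_univ _),
      Finset.card_sdiff_of_subset (Finset.subset_univ _), Finset.card_univ, Finset.card_univ]
    omega)
  simp only [Finset.mem_sdiff, Finset.mem_univ, true_and] at hm
  refine ⟨fun v => if v ∈ S then f v else h v, ?_, ?_, ?_⟩
  · intro a b hab
    simp only at hab
    by_cases h1 : a ∈ S <;> by_cases h2 : b ∈ S
    · rw [if_pos h1, if_pos h2] at hab; exact hinj h1 h2 hab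
    · rw [if_pos h1, if_neg h2] at hab
      exact absurd (hab ▸ hfB a h1) (hm b h2)
    · rw [if_neg h1, if_pos h2] at hab
      exact absurd (hab ▸ hfB b h2) (hm a h1)
    · rw [if_neg h1, if_neg h2] at hab; exact hi (by simpa using h1) (by simpa using h2) hab
  · intro v hv; simp [hv]
  · intro v hv; simp only [if_neg hv]; exact hm v hv

/-- Colour of an edge under an embedding. -/
def zsEdge {V W : Type*} {p : ℕ} (χ : W → W → ZMod p) (hsym : ∀ x y, χ x y = χ y x)
    (f : V → W) : Sym2 V → ZMod p :=
  Sym2.lift ⟨fun x y => χ (f x) (f y), fun x y => hsym (f x) (f y)⟩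

/-- There is a zero-sum copy. -/
def ZSCopy {V W : Type*} [Fintype V] [DecidableEq V] (F : SimpleGraph V)
    [DecidableRel F.Adj] {p : ℕ} (χ : W → W → ZMod p) (hsym : ∀ x y, χ x y = χ y x) : Prop :=
  ∃ f : V → W, Function.Injective f ∧ ∑ e ∈ F.edgeFinset, zsEdge χ hsym f e = 0

lemma zs_mono {V W : Type*} [Fintype V] [DecidableEq V] [Fintype W] [DecidableEq W]
    (F : SimpleGraph V) [DecidableRel F.Adj] {p : ℕ} (χ : W → W → ZMod p)
    (hsym : ∀ x y, χ x y = χ y x) (hdiv : p ∣ #F.edgeFinset)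
    (hcard : Fintype.card V ≤ Fintype.card W)
    (S : Finset V) (hS : ∀ u v, F.Adj u v → u ∈ S) (f : V → W) (hf : Set.InjOn f S)
    (k : ZMod p) (hk : ∀ u ∈ S, ∀ v ∈ S, F.Adj u v → χ (f u) (f v) = k) : ZSCopy F χ hsym := by
  obtain ⟨g, hg, hgf, -⟩ := zs_extend f S (S.image f) hf
    (fun v hv => Finset.mem_image_of_mem _ hv)
    (by have := Finset.card_image_le (s := S) (f := f); omega)
  refine ⟨g, hg, ?_⟩
  have : ∀ e ∈ F.edgeFinset, zsEdge χ hsym g e = k := by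
    intro e
    induction e with
    | _ u v =>
      intro he
      have hadj : F.Adj u v := by simpa using he
      have hu := hS u v hadj
      have hv := hS v u hadj.symm
      change χ (g u) (g v) = k
      rw [hgf u hu, hgf v hv]
      exact hk u hu v hv hadj
  rw [Finset.sum_congr rfl this, Finset.sum_const, nsmul_eq_mul]
  rw [(ZMod.natCast_eq_zero_iff _ _).2 hdiv, zero_mul]

/-- Sum over the edges, splitting off an independent set. -/
lemma zs_edge_split {V M : Type*} [Fintype V] [DecidableEq V] [AddCommMonoid M]
    (F : SimpleGraph V) [DecidableRel F.Adj] (I : Finset V)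
    (hI : ∀ u ∈ I, ∀ v ∈ I, ¬ F.Adj u v) (φ : Sym2 V → M) :
    ∑ e ∈ F.edgeFinset, φ e = ∑ e ∈ F.edgeFinset with (∀ v ∈ I, v ∉ e), φ e
      + ∑ v ∈ I, ∑ u ∈ F.neighborFinset v, φ s(v, u) := by
  rw [← Finset.sum_filter_add_sum_filter_not F.edgeFinset (fun e => ∀ v ∈ I, v ∉ e)]
  congr 1
  have h1 : ∀ v ∈ I, ∑ u ∈ F.neighborFinset v, φ s(v, u)
      = ∑ e ∈ (F.neighborFinset v).image (fun u => s(v, u)), φ e := by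
    intro v _
    rw [Finset.sum_image]
    intro a _ b _ hab
    rcases Sym2.eq_iff.1 hab with ⟨_, h⟩ | ⟨h1, h2⟩
    · exact h
    · exact h2.trans h1
  rw [Finset.sum_congr rfl h1, ← Finset.sum_biUnion]
  · apply Finset.sum_congr _ (fun _ _ => rfl)
    ext e
    induction e with
    | _ a b =>
      simp only [Finset.mem_filter, SimpleGraph.mem_edgeFinset, SimpleGraph.mem_edgeSet,
        Finset.mem_biUnion, Finset.mem_image, SimpleGraph.mem_neighborFinset]
      constructor
      · rintro ⟨hab, h⟩
        push Not at h
        obtain ⟨v, hv, hve⟩ := h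
        rcases Sym2.mem_iff.1 hve with rfl | rfl
        · exact ⟨v, hv, b, hab, rfl⟩
        · exact ⟨v, hv, a, hab.symm, Sym2.eq_swap⟩
      · rintro ⟨v, hv, u, hvu, he⟩
        refine ⟨?_, ?_⟩
        · rw [← SimpleGraph.mem_edgeSet, ← he]; exact hvu
        · push Not
          exact ⟨v, hv, by rw [← he]; exact Sym2.mem_mk_left _ _⟩
  · intro v hv w hw hvw
    rw [Function.onFun, Finset.disjoint_left]
    intro e he he'
    simp only [Finset.mem_image, SimpleGraph.mem_neighborFinset] at he he'
    obtain ⟨u, hu, rfl⟩ := he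
    obtain ⟨u', hu', he⟩ := he'
    rcases Sym2.eq_iff.1 he with ⟨h, _⟩ | ⟨h, h'⟩
    · exact hvw h.symm
    · exact hI v hv w hw (h ▸ hu)

/-- The positions reserved for the switch: one for each vertex of `J`, two for each of `I`. -/
def zsKeys {V : Type*} [DecidableEq V] (J I : Finset V) : Finset (V × Bool) :=
  (J ×ˢ {false}) ∪ (I ×ˢ {false, true})

lemma mem_zsKeys {V : Type*} [DecidableEq V] (J I : Finset V) (x : V) (b : Bool) :
    (x, b) ∈ zsKeys J I ↔ (x ∈ J ∧ b = false) ∨ x ∈ I := by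
  cases b <;> simp [zsKeys]

lemma card_zsKeys {V : Type*} [DecidableEq V] (J I : Finset V) :
    #(zsKeys J I) ≤ #J + 2 * #I := by
  refine (Finset.card_union_le _ _).trans ?_
  simp only [Finset.card_product]
  simp; omega

/-- A switch system on `J`, `I`. -/
def ZSSwitch {V W : Type*} [Fintype V] [DecidableEq V] (F : SimpleGraph V)
    [DecidableRel F.Adj] {p : ℕ} (χ : W → W → ZMod p) (J I : Finset V) (Φ : V × Bool → W) : Prop :=
  Set.InjOn Φ (zsKeys J I) ∧ ∀ v ∈ I,
    ∑ u ∈ F.neighborFinset v, χ (Φ (u, false)) (Φ (v, false)) ≠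
    ∑ u ∈ F.neighborFinset v, χ (Φ (u, false)) (Φ (v, true))

lemma zs_switch {V W : Type*} [Fintype V] [DecidableEq V] [Fintype W] [DecidableEq W]
    (F : SimpleGraph V) [DecidableRel F.Adj] {p : ℕ} [Fact p.Prime] (χ : W → W → ZMod p)
    (hsym : ∀ x y, χ x y = χ y x) (J I : Finset V) (hJI : Disjoint J I)
    (hN : ∀ v ∈ I, ∀ u, F.Adj v u → u ∈ J) (hI : p ≤ #I + 1)
    (hcard : Fintype.card V + #I ≤ Fintype.card W)
    (Φ : V × Bool → W) (hΦ : ZSSwitch F χ J I Φ) : ZSCopy F χ hsym := by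
  obtain ⟨hinj, hne⟩ := hΦ
  have hcd : #(J ∪ I) = #J + #I := Finset.card_union_of_disjoint hJI
  obtain ⟨g, hg, hgf, hgB⟩ := zs_extend (fun v => Φ (v, false)) (J ∪ I) ((zsKeys J I).image Φ)
    (by
      intro a ha b hb hab
      have ha' : a ∈ J ∪ I := ha
      have hb' : b ∈ J ∪ I := hb
      have := @hinj (a, false) (by
        rw [Finset.mem_coe, mem_zsKeys]; simpa using ha') (b, false) (by
        rw [Finset.mem_coe, mem_zsKeys]; simpa using hb') hab
      exact congrArg Prod.fst this)
    (by
      intro v hv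
      exact Finset.mem_image_of_mem _ (by rw [mem_zsKeys]; simpa using hv))
    (by
      have h1 := Finset.card_image_le (s := zsKeys J I) (f := Φ)
      have h2 := card_zsKeys J I
      omega)
  have hInJ : ∀ v ∈ I, v ∉ J := fun v hv hj => Finset.disjoint_left.1 hJI hj hv
  have hind : ∀ u ∈ I, ∀ v ∈ I, ¬ F.Adj u v := fun u hu v hv h => hInJ v hv (hN u hu v h)
  let f : (V → Bool) → V → W := fun s v => if v ∈ I ∧ s v = true then Φ (v, true) else g v
  have hfI : ∀ s, ∀ v ∈ I, f s v = Φ (v, s v) := by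
    intro s v hv
    cases hsv : s v
    · simp [f, hsv, hgf v (Finset.mem_union_right _ hv)]
    · simp [f, hsv, hv]
  have hfn : ∀ s, ∀ v ∉ I, f s v = g v := by
    intro s v hv; simp [f, hv]
  have hfJ : ∀ s, ∀ v ∈ J, f s v = Φ (v, false) := by
    intro s v hv
    rw [hfn s v (fun h => hInJ v h hv), hgf v (Finset.mem_union_left _ hv)]
  -- injectivity
  have hfinj : ∀ s, Function.Injective (f s) := by
    intro s
    have key : ∀ a ∈ I, ∀ b ∉ I, f s a ≠ f s b := by
      intro a ha b hb hab
      rw [hfI s a ha, hfn s b hb] at hab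
      by_cases hbJ : b ∈ J
      · rw [hgf b (Finset.mem_union_left _ hbJ)] at hab
        have := @hinj (a, s a) (by rw [Finset.mem_coe, mem_zsKeys]; exact Or.inr ha) (b, false)
          (by rw [Finset.mem_coe, mem_zsKeys]; exact Or.inl ⟨hbJ, rfl⟩) hab
        have : a = b := congrArg Prod.fst this
        exact hb (this ▸ ha)
      · have := hgB b (by simp [hbJ, hb])
        rw [← hab] at this
        exact this (Finset.mem_image_of_mem _ (by rw [mem_zsKeys]; exact Or.inr ha))
    intro a b hab
    by_cases h1 : a ∈ I <;> by_cases h2 : b ∈ I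
    · rw [hfI s a h1, hfI s b h2] at hab
      have := @hinj (a, s a) (by rw [Finset.mem_coe, mem_zsKeys]; exact Or.inr h1) (b, s b)
          (by rw [Finset.mem_coe, mem_zsKeys]; exact Or.inr h2) hab
      exact congrArg Prod.fst this
    · exact absurd hab (key a h1 b h2)
    · exact absurd hab.symm (key b h2 a h1)
    · rw [hfn s a h1, hfn s b h2] at hab; exact hg hab
  set A : V → ZMod p := fun v => ∑ u ∈ F.neighborFinset v, χ (Φ (u, false)) (Φ (v, false)) with hA
  set B : V → ZMod p := fun v => ∑ u ∈ F.neighborFinset v, χ (Φ (u, false)) (Φ (v, true)) with hB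
  set C : ZMod p := ∑ e ∈ F.edgeFinset with (∀ v ∈ I, v ∉ e), zsEdge χ hsym g e with hC
  have hsum : ∀ s, ∑ e ∈ F.edgeFinset, zsEdge χ hsym (f s) e
      = C + ∑ v ∈ I, (if s v then B v else A v) := by
    intro s
    rw [zs_edge_split F I hind]
    congr 1
    · apply Finset.sum_congr rfl
      intro e
      induction e with
      | _ a b =>
        intro he
        simp only [Finset.mem_filter] at he
        have ha : a ∉ I := fun h => he.2 a h (Sym2.mem_mk_left _ _)
        have hb : b ∉ I := fun h => he.2 b h (Sym2.mem_mk_right _ _)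
        change χ (f s a) (f s b) = χ (g a) (g b)
        rw [hfn s a ha, hfn s b hb]
    · apply Finset.sum_congr rfl
      intro v hv
      have : ∑ u ∈ F.neighborFinset v, zsEdge χ hsym (f s) s(v, u)
          = ∑ u ∈ F.neighborFinset v, χ (Φ (u, false)) (Φ (v, s v)) := by
        apply Finset.sum_congr rfl
        intro u hu
        rw [SimpleGraph.mem_neighborFinset] at hu
        change χ (f s v) (f s u) = _
        rw [hsym, hfI s v hv, hfJ s u (hN v hv u hu)]
      rw [this]
      cases s v <;> simp [A, B]
  obtain ⟨T, hT, hTs⟩ := zs_cd p I A B (fun v hv => hne v hv)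
  have hTu : T = Finset.univ := by
    rw [← Finset.card_eq_iff_eq_univ, ZMod.card]
    have h1 := Finset.card_le_univ T
    rw [ZMod.card] at h1
    omega
  obtain ⟨s, hs⟩ := hTs (-C) (by rw [hTu]; simp)
  exact ⟨f s, hfinj s, by rw [hsum, hs]; simp⟩

/-- Disjoint pairs on which `h` differs. -/
lemma zs_pairs {V W : Type*} [DecidableEq W] [Nonempty W] {p : ℕ} [Fact p.Prime]
    (L : Finset V) (S : Finset W) (h : W → ZMod p) (h1 : p * #L ≤ #S)
    (h2 : ∀ k, #L ≤ #{y ∈ S | h y ≠ k}) :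
    ∃ Ψ : V × Bool → W, (∀ v ∈ L, ∀ w ∈ L, ∀ b c, Ψ (v, b) = Ψ (w, c) → (v, b) = (w, c)) ∧
      (∀ v ∈ L, ∀ b, Ψ (v, b) ∈ S) ∧ ∀ v ∈ L, h (Ψ (v, false)) ≠ h (Ψ (v, true)) := by
  classical
  obtain ⟨k, -, hk⟩ := Finset.exists_le_card_fiber_of_mul_le_card_of_maps_to
    (s := S) (t := (Finset.univ : Finset (ZMod p))) (f := h) (n := #L)
    (fun _ _ => Finset.mem_univ _) ⟨0, Finset.mem_univ _⟩ (by
      rw [Finset.card_univ, ZMod.card]; exact h1)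
  obtain ⟨f, hf, hfS⟩ := zs_inj L _ (h2 k)
  obtain ⟨g, hg, hgS⟩ := zs_inj L _ hk
  simp only [Finset.mem_filter] at hfS hgS
  refine ⟨fun x => if x.2 then g x.1 else f x.1, ?_, ?_, ?_⟩
  · intro v hv w hw b c hbc
    cases b <;> cases c <;> simp at hbc ⊢
    · exact hf hv hw hbc
    · exact (hfS v hv).2 (hbc ▸ (hgS w hw).2)
    · exact (hfS w hw).2 (hbc ▸ (hgS v hv).2)
    · exact hg hv hw hbc
  · intro v hv b
    cases b
    · simpa using (hfS v hv).1
    · simpa using (hgS v hv).1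
  · intro v hv
    simp only [Bool.false_eq_true, if_false, if_true]
    rw [(hgS v hv).2]
    exact (hfS v hv).2

/-- Gluing one more vertex `u` of `J` onto a switch system. -/
lemma zs_glue {V W : Type*} [Fintype V] [DecidableEq V] [DecidableEq W]
    (F : SimpleGraph V) [DecidableRel F.Adj] {p : ℕ} (χ : W → W → ZMod p)
    (J I : Finset V) (hJI : Disjoint J I) (u : V) (hu : u ∈ J)
    (hN : ∀ v ∈ I, ∀ w, F.Adj v w → w ∈ J)
    (Φ : V × Bool → W) (hΦ : ZSSwitch F χ (J.erase u) (I.filter (fun v => ¬ F.Adj u v)) Φ)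
    (U : Finset W) (hU : U = (zsKeys (J.erase u) (I.filter (fun v => ¬ F.Adj u v))).image Φ)
    (x : W) (hx : x ∉ U) (Ψ : V × Bool → W)
    (hΨ : ∀ v ∈ I, F.Adj u v → ∀ w ∈ I, F.Adj u w → ∀ b c, Ψ (v, b) = Ψ (w, c) → (v, b) = (w, c))
    (hΨU : ∀ v ∈ I, F.Adj u v → ∀ b, Ψ (v, b) ∉ U ∧ Ψ (v, b) ≠ x)
    (hne : ∀ v ∈ I, F.Adj u v →
      χ x (Ψ (v, false)) + ∑ w ∈ (F.neighborFinset v).erase u, χ (Φ (w, false)) (Ψ (v, false)) ≠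
      χ x (Ψ (v, true)) + ∑ w ∈ (F.neighborFinset v).erase u, χ (Φ (w, false)) (Ψ (v, true))) :
    ∃ Φ' : V × Bool → W, ZSSwitch F χ J I Φ' := by
  obtain ⟨hinj, hsw⟩ := hΦ
  have hInJ : ∀ v ∈ I, v ∉ J := fun v hv hj => Finset.disjoint_left.1 hJI hj hv
  let Φ' : V × Bool → W := fun a => if a.1 = u then x else
    if a.1 ∈ I ∧ F.Adj u a.1 then Ψ a else Φ a
  have e1 : ∀ b, Φ' (u, b) = x := by intro b; simp [Φ']
  have e2 : ∀ v ∈ I, F.Adj u v → ∀ b, Φ' (v, b) = Ψ (v, b) := by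
    intro v hv hvu b
    have : v ≠ u := hvu.ne'
    simp [Φ', this, hv, hvu]
  have e3 : ∀ v b, v ≠ u → ¬ (v ∈ I ∧ F.Adj u v) → Φ' (v, b) = Φ (v, b) := by
    intro v b h1 h2
    simp only [Φ', if_neg h1, if_neg h2]
  -- classification of keys
  have hcl : ∀ v b, (v, b) ∈ zsKeys J I → (v = u ∧ b = false ∧ Φ' (v, b) = x) ∨
      (v ∈ I ∧ F.Adj u v ∧ Φ' (v, b) = Ψ (v, b)) ∨
      ((v, b) ∈ zsKeys (J.erase u) (I.filter (fun v => ¬ F.Adj u v)) ∧ Φ' (v, b) = Φ (v, b)) := by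
    intro v b h
    rw [mem_zsKeys] at h
    rcases h with ⟨hv, rfl⟩ | hv
    · by_cases hvu : v = u
      · left; subst hvu; exact ⟨rfl, rfl, e1 _⟩
      · right; right
        refine ⟨?_, e3 _ _ hvu (fun h => hInJ v h.1 hv)⟩
        rw [mem_zsKeys]; left; simp [hv, hvu]
    · have hvu : v ≠ u := fun h => hInJ v hv (h ▸ hu)
      by_cases ha : F.Adj u v
      · right; left; exact ⟨hv, ha, e2 v hv ha b⟩
      · right; right
        refine ⟨?_, e3 _ _ hvu (fun h => ha h.2)⟩
        rw [mem_zsKeys]; right; simp [hv, ha]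
  have hUm : ∀ a ∈ zsKeys (J.erase u) (I.filter (fun v => ¬ F.Adj u v)), Φ a ∈ U := by
    intro a ha; rw [hU]; exact Finset.mem_image_of_mem _ ha
  refine ⟨Φ', ?_, ?_⟩
  · rintro ⟨v, b⟩ ha ⟨w, c⟩ hb hab
    rcases hcl v b ha with ⟨h1, h2, h3⟩ | ⟨h1, h2, h3⟩ | ⟨h1, h3⟩ <;>
    rcases hcl w c hb with ⟨k1, k2, k3⟩ | ⟨k1, k2, k3⟩ | ⟨k1, k3⟩ <;> rw [h3, k3] at hab
    · rw [h1, k1, h2, k2]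
    · exact absurd hab.symm (hΨU w k1 k2 c).2
    · exact absurd (hab ▸ hUm _ k1) hx
    · exact absurd hab (hΨU v h1 h2 b).2
    · exact hΨ v h1 h2 w k1 k2 b c hab
    · exact absurd (hab ▸ hUm _ k1) (hΨU v h1 h2 b).1
    · exact absurd (hab ▸ hUm _ h1) hx
    · exact absurd (hab ▸ hUm _ h1) (hΨU w k1 k2 c).1
    · exact hinj h1 k1 hab
  · intro v hv
    have hvu : v ≠ u := fun h => hInJ v hv (h ▸ hu)
    by_cases ha : F.Adj u v
    · have hmem : u ∈ F.neighborFinset v := by simpa using ha.symm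
      have hs : ∀ b, ∑ w ∈ F.neighborFinset v, χ (Φ' (w, false)) (Φ' (v, b))
          = χ x (Ψ (v, b)) + ∑ w ∈ (F.neighborFinset v).erase u, χ (Φ (w, false)) (Ψ (v, b)) := by
        intro b
        rw [← Finset.add_sum_erase _ _ hmem, e1, e2 v hv ha]
        congr 1
        apply Finset.sum_congr rfl
        intro w hw
        rw [Finset.mem_erase, SimpleGraph.mem_neighborFinset] at hw
        rw [e3 w false hw.1 (fun h => hInJ w h.1 (hN v hv w hw.2))]
      rw [hs, hs]
      exact hne v hv ha
    · have hs : ∀ b, ∑ w ∈ F.neighborFinset v, χ (Φ' (w, false)) (Φ' (v, b))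
          = ∑ w ∈ F.neighborFinset v, χ (Φ (w, false)) (Φ (v, b)) := by
        intro b
        apply Finset.sum_congr rfl
        intro w hw
        rw [SimpleGraph.mem_neighborFinset] at hw
        rw [e3 w false (fun h => ha (h ▸ hw.symm)) (fun h => hInJ w h.1 (hN v hv w hw)),
          e3 v b hvu (fun h => ha h.2)]
      rw [hs, hs]
      exact hsw v (by simp [hv, ha])

/-- The structural obstruction to building a switch system. -/
def ZSBad {W : Type*} [Fintype W] [DecidableEq W] {p : ℕ} (χ : W → W → ZMod p) (q : ℕ) : Prop :=
  ∃ (U : Finset W) (g : W → ZMod p) (E : ℕ), E ≤ q ∧ #U + 2 * E + 2 ≤ 4 * q ∧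
    ∀ x ∉ U, (∃ k, ∀ z ∉ U, z ≠ x → χ x z + g z = k) ∨
      (∃ k, #{z | z ∉ U ∧ z ≠ x ∧ χ x z ≠ k} ≤ E)

lemma zs_chain {V W : Type*} [Fintype V] [DecidableEq V] [Fintype W] [DecidableEq W]
    (F : SimpleGraph V) [DecidableRel F.Adj] (hF : F.IsAcyclic) {p : ℕ} [Fact p.Prime]
    (χ : W → W → ZMod p) (q : ℕ) (hp : p = q + 1)
    (hW : 3 * q ^ 2 + 3 * q ≤ Fintype.card W + 1) (j : ℕ) :
    ∀ J I : Finset V, #J = j → Disjoint J I → (∀ v ∈ I, ∀ w, F.Adj v w → w ∈ J) →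
      (∀ v ∈ I, ∃ w, F.Adj v w) → #J + 1 ≤ 2 * q → #I ≤ q →
      (∃ Φ : V × Bool → W, ZSSwitch F χ J I Φ) ∨ ZSBad χ q := by
  have hq : 1 ≤ q := by
    have := (Fact.out : p.Prime).two_le
    omega
  have hWne : Nonempty W := by
    rw [← Fintype.card_pos_iff]
    nlinarith
  induction j with
  | zero =>
    intro J I hJ hJI hN hne _ _
    left
    rw [Finset.card_eq_zero] at hJ
    subst hJ
    have hI : ∀ v, v ∉ I := by
      intro v hv
      obtain ⟨w, hw⟩ := hne v hv
      exact absurd (hN v hv w hw) (Finset.notMem_empty _)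
    refine ⟨fun _ => Classical.arbitrary W, ?_, fun v hv => (hI v hv).elim⟩
    rintro ⟨v, b⟩ h
    rw [Finset.mem_coe, mem_zsKeys] at h
    rcases h with ⟨h, _⟩ | h
    · exact absurd h (Finset.notMem_empty _)
    · exact (hI v h).elim
  | succ j ih =>
    intro J I hJ hJI hN hne hJq hIq
    have hInJ : ∀ v ∈ I, v ∉ J := fun v hv hj => Finset.disjoint_left.1 hJI hj hv
    set I2 := I.filter (fun v => 2 ≤ #(F.neighborFinset v)) with hI2
    -- a vertex of `J` with at most one neighbour in `I2`
    obtain ⟨u, huJ, hu1⟩ : ∃ u ∈ J, #{w ∈ I2 | F.Adj u w} ≤ 1 := by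
      obtain ⟨u, hu, hu1⟩ := zs_degen F hF (I2 ∪ J) (by
        have : J.Nonempty := by rw [← Finset.card_pos]; omega
        exact this.mono Finset.subset_union_right)
      rcases Finset.mem_union.1 hu with h | h
      · exfalso
        rw [hI2, Finset.mem_filter] at h
        have hsub : F.neighborFinset u ⊆ {w ∈ I2 ∪ J | F.Adj u w} := by
          intro w hw
          rw [SimpleGraph.mem_neighborFinset] at hw
          simp [hw, hN u h.1 w hw]
        have := Finset.card_le_card hsub
        omega
      · refine ⟨u, h, le_trans (Finset.card_le_card ?_) hu1⟩
        exact Finset.filter_subset_filter _ Finset.subset_union_left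
    set I' := I.filter (fun v => ¬ F.Adj u v) with hI'
    set J' := J.erase u with hJ'
    have hJ'c : #J' = j := by rw [hJ', Finset.card_erase_of_mem huJ]; omega
    have hI'c : #{v ∈ I | F.Adj u v} + #I' = #I :=
      Finset.card_filter_add_card_filter_not _
    rcases ih J' I' hJ'c
      (Finset.disjoint_of_subset_left (Finset.erase_subset _ _)
        (Finset.disjoint_of_subset_right (Finset.filter_subset _ _) hJI))
      (by
        intro v hv w hvw
        rw [hI', Finset.mem_filter] at hv
        rw [hJ', Finset.mem_erase]
        exact ⟨fun h => hv.2 (h ▸ hvw.symm), hN v hv.1 w hvw⟩)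
      (by
        intro v hv
        rw [hI', Finset.mem_filter] at hv
        exact hne v hv.1) (by omega) (by omega) with ⟨Φ, hΦ⟩ | hbad
    swap
    · exact Or.inr hbad
    set U := (zsKeys J' I').image Φ with hU
    have hUc : #U ≤ #J' + 2 * #I' := Finset.card_image_le.trans (card_zsKeys _ _)
    set L := I.filter (fun v => F.Adj u v ∧ ¬ 2 ≤ #(F.neighborFinset v)) with hL
    have hLd : ∀ v ∈ L, (F.neighborFinset v).erase u = ∅ := by
      intro v hv
      rw [hL, Finset.mem_filter] at hv
      rw [← Finset.card_eq_zero, Finset.card_erase_of_mem (by simpa using hv.2.1.symm)]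
      omega
    have hUcompl : #(Finset.univ \ U) = Fintype.card W - #U := by
      rw [Finset.card_sdiff_of_subset (Finset.subset_univ _), Finset.card_univ]
    have hLsub : L ⊆ {v ∈ I | F.Adj u v} := by
      intro v hv
      rw [hL, Finset.mem_filter] at hv
      simp [hv.1, hv.2.1]
    by_cases hv0 : ∃ v0 ∈ I2, F.Adj u v0
    · obtain ⟨v0, hv0, huv0⟩ := hv0
      have hv0I : v0 ∈ I := (Finset.mem_filter.1 hv0).1
      have hv0L : v0 ∉ L := by
        rw [hL, Finset.mem_filter]
        intro h
        exact h.2.2 (Finset.mem_filter.1 hv0).2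
      have huniq : ∀ v ∈ I, F.Adj u v → v = v0 ∨ v ∈ L := by
        intro v hv huv
        by_cases hd : 2 ≤ #(F.neighborFinset v)
        · left
          rw [Finset.card_le_one] at hu1
          exact hu1 v (Finset.mem_filter.2 ⟨Finset.mem_filter.2 ⟨hv, hd⟩, huv⟩) v0
            (Finset.mem_filter.2 ⟨hv0, huv0⟩)
        · right; exact Finset.mem_filter.2 ⟨hv, huv, hd⟩
      have hLc : #L + 1 ≤ #{v ∈ I | F.Adj u v} := by
        rw [← Finset.card_insert_of_notMem hv0L]
        apply Finset.card_le_card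
        apply Finset.insert_subset _ hLsub
        simp [hv0I, huv0]
      set g : W → ZMod p := fun z => ∑ w ∈ (F.neighborFinset v0).erase u, χ (Φ (w, false)) z with hg
      by_cases hgood : ∃ x ∉ U, ∃ z ∉ U, ∃ w ∉ U, z ≠ x ∧ w ≠ x ∧ χ x z + g z ≠ χ x w + g w ∧
          ∀ k, #L ≤ #{y ∈ ((Finset.univ \ U) \ {x, z, w}) | χ x y ≠ k}
      · left
        obtain ⟨x, hx, z, hz, w, hw, hzx, hwx, hzw, hk⟩ := hgood
        have hS : p * #L ≤ #((Finset.univ \ U) \ {x, z, w}) := by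
          have h1 := Finset.le_card_sdiff ({x, z, w} : Finset W) (Finset.univ \ U)
          have h2 : #({x, z, w} : Finset W) ≤ 3 := Finset.card_le_three
          have h3 : #L + 1 ≤ q := by omega
          have h4 : p * #L + (4 * q - 1) ≤ Fintype.card W + 2 * #L := by
            rw [hp]
            obtain ⟨t, rfl⟩ : ∃ t, q = #L + 1 + t := ⟨q - (#L + 1), by omega⟩
            have : 4 * (#L + 1 + t) - 1 = 4 * #L + 4 * t + 3 := by omega
            rw [this]
            nlinarith
          omega
        obtain ⟨Ψ, hΨ1, hΨ2, hΨ3⟩ := zs_pairs L _ (fun y => χ x y) hS hk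
        have hΨ2' : ∀ v ∈ L, ∀ b, Ψ (v, b) ∉ U ∧ Ψ (v, b) ≠ x ∧ Ψ (v, b) ≠ z ∧ Ψ (v, b) ≠ w := by
          intro v hv b
          have := hΨ2 v hv b
          simpa using this
        have hzw' : z ≠ w := fun h => hzw (by rw [h])
        let Ψ' : V × Bool → W := fun a => if a.1 = v0 then (if a.2 then w else z) else Ψ a
        have e0 : Ψ' (v0, false) = z := by simp [Ψ']
        have e1 : Ψ' (v0, true) = w := by simp [Ψ']
        have e2 : ∀ v ∈ L, ∀ b, Ψ' (v, b) = Ψ (v, b) := by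
          intro v hv b
          have : v ≠ v0 := fun h => hv0L (h ▸ hv)
          simp [Ψ', this]
        refine zs_glue F χ J I hJI u huJ hN Φ hΦ U hU x hx Ψ' ?_ ?_ ?_
        · intro v hv huv v' hv' huv' b c hbc
          rcases huniq v hv huv with rfl | h1 <;> rcases huniq v' hv' huv' with rfl | h2
          · cases b <;> cases c <;> simp only [e0, e1] at hbc ⊢
            · exact absurd hbc hzw'
            · exact absurd hbc.symm hzw'
          · rw [e2 v' h2] at hbc
            have := hΨ2' v' h2 c
            cases b <;> simp only [e0, e1] at hbc
            · exact absurd hbc.symm this.2.2.1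
            · exact absurd hbc.symm this.2.2.2
          · rw [e2 v h1] at hbc
            have := hΨ2' v h1 b
            cases c <;> simp only [e0, e1] at hbc
            · exact absurd hbc this.2.2.1
            · exact absurd hbc this.2.2.2
          · rw [e2 v h1, e2 v' h2] at hbc
            exact hΨ1 v h1 v' h2 b c hbc
        · intro v hv huv b
          rcases huniq v hv huv with rfl | h1
          · cases b <;> simp only [e0, e1]
            · exact ⟨hz, hzx⟩
            · exact ⟨hw, hwx⟩
          · rw [e2 v h1]
            exact ⟨(hΨ2' v h1 b).1, (hΨ2' v h1 b).2.1⟩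
        · intro v hv huv
          rcases huniq v hv huv with rfl | h1
          · rw [e0, e1]; exact hzw
          · rw [hLd v h1, e2 v h1, e2 v h1]
            simpa using hΨ3 v h1
      · right
        push Not at hgood
        refine ⟨U, g, #L + 1, by omega, by omega, ?_⟩
        intro x hx
        by_cases hall : ∃ k, ∀ z ∉ U, z ≠ x → χ x z + g z = k
        · exact Or.inl hall
        · right
          push Not at hall
          obtain ⟨z, hz, hzx, -⟩ := hall 0
          obtain ⟨w, hw, hwx, hzw⟩ := hall (χ x z + g z)
          obtain ⟨k, hk⟩ := hgood x hx z hz w hw hzx hwx hzw.symm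
          refine ⟨k, ?_⟩
          have hsub : ({y | y ∉ U ∧ y ≠ x ∧ χ x y ≠ k} : Finset W) ⊆
              {y ∈ ((Finset.univ \ U) \ {x, z, w}) | χ x y ≠ k} ∪ {z, w} := by
            intro y hy
            simp only [Finset.mem_filter, Finset.mem_univ, true_and] at hy
            simp only [Finset.mem_union, Finset.mem_filter, Finset.mem_sdiff, Finset.mem_univ,
              true_and, Finset.mem_insert, Finset.mem_singleton]
            tauto
          have h1 := Finset.card_le_card hsub
          have h2 := Finset.card_union_le {y ∈ ((Finset.univ \ U) \ {x, z, w}) | χ x y ≠ k} {z, w}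
          have h3 : #({z, w} : Finset W) ≤ 2 := Finset.card_le_two
          omega
    · have hLeq : ∀ v ∈ I, F.Adj u v → v ∈ L := by
        intro v hv huv
        by_cases hd : 2 ≤ #(F.neighborFinset v)
        · exact absurd ⟨v, Finset.mem_filter.2 ⟨hv, hd⟩, huv⟩ hv0
        · exact Finset.mem_filter.2 ⟨hv, huv, hd⟩
      have hLc : #L ≤ #{v ∈ I | F.Adj u v} := Finset.card_le_card hLsub
      by_cases hgood : ∃ x ∉ U, ∀ k, #L ≤ #{y ∈ ((Finset.univ \ U) \ {x}) | χ x y ≠ k}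
      · left
        obtain ⟨x, hx, hk⟩ := hgood
        have hS : p * #L ≤ #((Finset.univ \ U) \ {x}) := by
          have h1 := Finset.le_card_sdiff ({x} : Finset W) (Finset.univ \ U)
          have h2 : #({x} : Finset W) = 1 := Finset.card_singleton _
          have h3 : #L ≤ q := by omega
          have h4 : p * #L + (4 * q - 1) ≤ Fintype.card W + 2 * #L := by
            rw [hp]
            obtain ⟨t, rfl⟩ : ∃ t, q = #L + t := ⟨q - #L, by omega⟩
            have : 4 * (#L + t) - 1 + 1 = 4 * #L + 4 * t := by omega
            nlinarith
          omega
        obtain ⟨Ψ, hΨ1, hΨ2, hΨ3⟩ := zs_pairs L _ (fun y => χ x y) hS hk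
        refine zs_glue F χ J I hJI u huJ hN Φ hΦ U hU x hx Ψ ?_ ?_ ?_
        · intro v hv huv v' hv' huv' b c hbc
          exact hΨ1 v (hLeq v hv huv) v' (hLeq v' hv' huv') b c hbc
        · intro v hv huv b
          have := hΨ2 v (hLeq v hv huv) b
          simpa using this
        · intro v hv huv
          rw [hLd v (hLeq v hv huv)]
          simpa using hΨ3 v (hLeq v hv huv)
      · right
        push Not at hgood
        have hUne : ∃ x, x ∉ U := by
          by_contra! h
          have : U = Finset.univ := by ext x; simp [h x]
          rw [this, Finset.card_univ] at hUc
          nlinarith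
        have hL1 : 1 ≤ #L := by
          obtain ⟨x, hx⟩ := hUne
          obtain ⟨k, hk⟩ := hgood x hx
          omega
        refine ⟨U, fun _ => 0, #L - 1, by omega, by omega, ?_⟩
        intro x hx
        right
        obtain ⟨k, hk⟩ := hgood x hx
        refine ⟨k, ?_⟩
        have : ({y | y ∉ U ∧ y ≠ x ∧ χ x y ≠ k} : Finset W) =
            {y ∈ ((Finset.univ \ U) \ {x}) | χ x y ≠ k} := by
          ext y
          simp [and_assoc]
        rw [this]
        omega

lemma zs_mono_greedy {V W : Type*} [Fintype V] [DecidableEq V] [Fintype W] [DecidableEq W]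
    (F : SimpleGraph V) [DecidableRel F.Adj] (hF : F.IsAcyclic) {p : ℕ}
    (χ : W → W → ZMod p) (hsym : ∀ x y, χ x y = χ y x) (hdiv : p ∣ #F.edgeFinset)
    (hVW : Fintype.card V < Fintype.card W)
    (A : Finset W) (κ : ZMod p) (E : ℕ) (hA : Fintype.card V + E ≤ #A)
    (hE : ∀ x ∈ A, #{y ∈ A | y ≠ x ∧ χ x y ≠ κ} ≤ E) : ZSCopy F χ hsym := by
  have : Nonempty W := by
    rw [← Fintype.card_pos_iff]; omega
  obtain ⟨f, hf, -, hfR⟩ := zs_greedy F hF (fun x y : W => x ≠ y ∧ χ x y = κ)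
    (fun x y h => ⟨h.1.symm, by rw [hsym]; exact h.2⟩) (fun x h => h.1 rfl) A Finset.univ
    (by rw [Finset.card_univ]; omega) (by
      intro x hx
      rw [Finset.card_univ]
      have hsub : A ⊆ {y ∈ A | x ≠ y ∧ χ x y = κ} ∪ ({y ∈ A | y ≠ x ∧ χ x y ≠ κ} ∪ {x}) := by
        intro y hy
        simp only [Finset.mem_union, Finset.mem_filter, Finset.mem_singleton, hy, true_and]
        by_cases h1 : y = x
        · simp [h1]
        · by_cases h2 : χ x y = κ
          · left; exact ⟨Ne.symm h1, h2⟩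
          · right; left; exact ⟨h1, h2⟩
      have h1 := Finset.card_le_card hsub
      have h2 := Finset.card_union_le {y ∈ A | x ≠ y ∧ χ x y = κ} ({y ∈ A | y ≠ x ∧ χ x y ≠ κ} ∪ {x})
      have h3 := Finset.card_union_le {y ∈ A | y ≠ x ∧ χ x y ≠ κ} {x}
      rw [Finset.card_singleton] at h3
      have := hE x hx
      omega)
  exact zs_mono F χ hsym hdiv hVW.le Finset.univ (fun _ _ _ => Finset.mem_univ _) f hf κ
    (fun u hu v hv h => (hfR u hu v hv h).2)

/-- Rows that are nearly constant on `Z` agree on most of `Z`. -/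
lemma zs_rows {W : Type*} [DecidableEq W] {p : ℕ} (χ : W → W → ZMod p)
    (hsym : ∀ x y, χ x y = χ y x) (Z : Finset W) (hZ : Z.Nonempty) (c : W → ZMod p) (E : ℕ)
    (hc : ∀ x ∈ Z, #{y ∈ Z | y ≠ x ∧ χ x y ≠ c x} ≤ E) :
    ∃ κ, #Z ≤ #{x ∈ Z | c x = κ} + 2 * E := by
  have hsum : ∑ y ∈ Z, #{x ∈ Z | y ≠ x ∧ χ x y ≠ c x} ≤ ∑ _y ∈ Z, E := by
    have := Finset.sum_card_bipartiteAbove_eq_sum_card_bipartiteBelow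
      (s := Z) (t := Z) (fun x y => y ≠ x ∧ χ x y ≠ c x)
    unfold Finset.bipartiteAbove Finset.bipartiteBelow at this
    rw [← this]
    exact Finset.sum_le_sum hc
  obtain ⟨x0, hx0, hx0E⟩ := Finset.exists_le_of_sum_le hZ hsum
  refine ⟨c x0, ?_⟩
  have hsub : Z ⊆ {x ∈ Z | c x = c x0} ∪ ({x ∈ Z | x0 ≠ x ∧ χ x x0 ≠ c x} ∪
      {y ∈ Z | y ≠ x0 ∧ χ x0 y ≠ c x0}) := by
    intro y hy
    simp only [Finset.mem_union, Finset.mem_filter, hy, true_and]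
    by_cases h1 : y = x0
    · left; rw [h1]
    · by_cases h2 : χ x0 y = c x0
      · by_cases h3 : χ y x0 = c y
        · left; rw [← h2, ← h3, hsym]
        · right; left; exact ⟨Ne.symm h1, h3⟩
      · right; right; exact ⟨h1, h2⟩
  have h1 := Finset.card_le_card hsub
  have h2 := Finset.card_union_le {x ∈ Z | c x = c x0} ({x ∈ Z | x0 ≠ x ∧ χ x x0 ≠ c x} ∪
      {y ∈ Z | y ≠ x0 ∧ χ x0 y ≠ c x0})
  have h3 := Finset.card_union_le {x ∈ Z | x0 ≠ x ∧ χ x x0 ≠ c x}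
      {y ∈ Z | y ≠ x0 ∧ χ x0 y ≠ c x0}
  have := hc x0 hx0
  omega

lemma zs_bad {V W : Type*} [Fintype V] [DecidableEq V] [Fintype W] [DecidableEq W]
    (F : SimpleGraph V) [DecidableRel F.Adj] (hF : F.IsAcyclic) {p : ℕ} [Fact p.Prime]
    (χ : W → W → ZMod p) (hsym : ∀ x y, χ x y = χ y x) (hdiv : p ∣ #F.edgeFinset)
    (q : ℕ) (hp : p = q + 1)
    (hW : 3 * q ^ 2 + 3 * q ≤ Fintype.card W + 1)
    (hVW : Fintype.card V + 9 * q ≤ Fintype.card W + 3)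
    (J I : Finset V) (hJI : Disjoint J I) (hN : ∀ v ∈ I, ∀ w, F.Adj v w → w ∈ J)
    (hdeg : ∀ v ∈ I, 1 ≤ #(F.neighborFinset v) ∧ #(F.neighborFinset v) ≤ q)
    (hJ : #J + 1 ≤ 2 * q) (hI : #I = q) (hbad : ZSBad χ q) : ZSCopy F χ hsym := by
  classical
  have hq : 1 ≤ q := by
    have := (Fact.out : p.Prime).two_le
    omega
  have hWne : Nonempty W := by
    rw [← Fintype.card_pos_iff]
    nlinarith
  obtain ⟨U, g, E, hEq, hUE, hrow⟩ := hbad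
  set Y : Finset W := (Finset.univ \ U).filter (fun x => ∃ k, ∀ z ∉ U, z ≠ x → χ x z + g z = k)
    with hY
  have hM : #(Finset.univ \ U) = Fintype.card W - #U := by
    rw [Finset.card_sdiff_of_subset (Finset.subset_univ _), Finset.card_univ]
  have hMmem : ∀ x, x ∈ Finset.univ \ U ↔ x ∉ U := by intro x; simp
  by_cases hYc : #Y + 2 ≤ 4 * q
  · -- few exceptional rows
    set Z : Finset W := (Finset.univ \ U) \ Y with hZ
    have hZc : #Z = #(Finset.univ \ U) - #Y :=
      Finset.card_sdiff_of_subset (Finset.filter_subset _ _)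
    have hk : ∀ x : W, ∃ k, x ∈ Z → #{z | z ∉ U ∧ z ≠ x ∧ χ x z ≠ k} ≤ E := by
      intro x
      by_cases hx : x ∈ Z
      · rw [hZ, Finset.mem_sdiff, hMmem] at hx
        rcases hrow x hx.1 with h | ⟨k, h⟩
        · exact absurd (Finset.mem_filter.2 ⟨(hMmem x).2 hx.1, h⟩) hx.2
        · exact ⟨k, fun _ => h⟩
      · exact ⟨0, fun h => absurd h hx⟩
    choose c hc using hk
    have hZU : ∀ x ∈ Z, x ∉ U := by
      intro x hx
      rw [hZ, Finset.mem_sdiff, hMmem] at hx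
      exact hx.1
    have hc' : ∀ x ∈ Z, #{y ∈ Z | y ≠ x ∧ χ x y ≠ c x} ≤ E := by
      intro x hx
      refine (Finset.card_le_card ?_).trans (hc x hx)
      intro y hy
      rw [Finset.mem_filter] at hy
      simp [hZU y hy.1, hy.2]
    obtain ⟨κ, hκ⟩ := zs_rows χ hsym Z (by rw [← Finset.card_pos]; omega) c E hc'
    refine zs_mono_greedy F hF χ hsym hdiv (by omega) {x ∈ Z | c x = κ} κ E (by omega) ?_
    intro x hx
    rw [Finset.mem_filter] at hx
    refine (Finset.card_le_card ?_).trans (hc' x hx.1)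
    intro y hy
    simp only [Finset.mem_filter] at hy ⊢
    rw [hx.2]
    exact ⟨hy.1.1, hy.2⟩
  · -- many exceptional rows
    have hYU : ∀ y ∈ Y, y ∉ U := by
      intro y hy
      exact (hMmem y).1 (Finset.mem_filter.1 hy).1
    obtain ⟨c, hc⟩ : ∃ c, ∀ y ∈ Y, ∀ z ∉ U, z ≠ y → χ y z = c - g y - g z := by
      obtain ⟨y0, hy0⟩ : Y.Nonempty := by rw [← Finset.card_pos]; omega
      obtain ⟨k0, hk0⟩ := (Finset.mem_filter.1 hy0).2
      refine ⟨k0 + g y0, ?_⟩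
      intro y hy z hz hzy
      obtain ⟨k, hk⟩ := (Finset.mem_filter.1 hy).2
      have h1 := hk z hz hzy
      by_cases hyy : y = y0
      · subst hyy
        have h2 := hk0 z hz hzy
        linear_combination h2
      · have h2 := hk0 y (hYU y hy) hyy
        have h3 := hk y0 (hYU y0 hy0) (Ne.symm hyy)
        rw [hsym y y0] at h3
        linear_combination h1 + h2 - h3
    obtain ⟨fJ, hfJ, hfJY⟩ := zs_inj J Y (by omega)
    set YJ := J.image fJ with hYJ
    have hYJc : #YJ ≤ #J := Finset.card_image_le
    set M' := (Finset.univ \ U) \ YJ with hM'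
    have hM'c : #(Finset.univ \ U) - #YJ ≤ #M' := Finset.le_card_sdiff YJ (Finset.univ \ U)
    by_cases hpairs : ∀ k, #I ≤ #{y ∈ M' | g y ≠ k}
    · have hsize : p * #I ≤ #M' := by
        rw [hI, hp]
        have : (q + 1) * q + 6 * q ≤ Fintype.card W + 3 := by
          obtain ⟨t, rfl⟩ : ∃ t, q = t + 1 := ⟨q - 1, by omega⟩
          nlinarith [sq_nonneg (t : ℤ)]
        omega
      obtain ⟨Ψ, hΨ1, hΨ2, hΨ3⟩ := zs_pairs I M' g hsize hpairs
      have hInJ : ∀ v ∈ I, v ∉ J := fun v hv hj => Finset.disjoint_left.1 hJI hj hv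
      let Φ : V × Bool → W := fun a => if a.1 ∈ I then Ψ a else fJ a.1
      have e1 : ∀ v ∈ I, ∀ b, Φ (v, b) = Ψ (v, b) := by intro v hv b; simp [Φ, hv]
      have e2 : ∀ v ∈ J, ∀ b, Φ (v, b) = fJ v := by
        intro v hv b
        have : v ∉ I := fun h => hInJ v h hv
        simp [Φ, this]
      have hne : ∀ v ∈ I, ∀ b, ∀ w ∈ J, Ψ (v, b) ≠ fJ w := by
        intro v hv b w hw h
        have := hΨ2 v hv b
        rw [hM', Finset.mem_sdiff] at this
        exact this.2 (h ▸ Finset.mem_image_of_mem _ hw)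
      have hΨU : ∀ v ∈ I, ∀ b, Ψ (v, b) ∉ U := by
        intro v hv b
        have := hΨ2 v hv b
        rw [hM', Finset.mem_sdiff, hMmem] at this
        exact this.1
      refine zs_switch F χ hsym J I hJI hN (by omega) (by omega) Φ ⟨?_, ?_⟩
      · rintro ⟨v, b⟩ ha ⟨w, d⟩ hb hab
        rw [Finset.mem_coe, mem_zsKeys] at ha hb
        rcases ha with ⟨ha, rfl⟩ | ha <;> rcases hb with ⟨hb, rfl⟩ | hb
        · rw [e2 v ha, e2 w hb] at hab
          rw [hfJ ha hb hab]
        · rw [e2 v ha, e1 w hb] at hab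
          exact absurd hab.symm (hne w hb d v ha)
        · rw [e1 v ha, e2 w hb] at hab
          exact absurd hab (hne v ha b w hb)
        · rw [e1 v ha, e1 w hb] at hab
          exact hΨ1 v ha w hb b d hab
      · intro v hv
        have hs : ∀ b, ∑ u ∈ F.neighborFinset v, χ (Φ (u, false)) (Φ (v, b))
            = ∑ u ∈ F.neighborFinset v, (c - g (fJ u))
              - (#(F.neighborFinset v) : ZMod p) * g (Ψ (v, b)) := by
          intro b
          rw [← nsmul_eq_mul, ← Finset.sum_const, ← Finset.sum_sub_distrib]
          apply Finset.sum_congr rfl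
          intro u hu
          rw [SimpleGraph.mem_neighborFinset] at hu
          have huJ := hN v hv u hu
          rw [e2 u huJ, e1 v hv]
          exact hc _ (hfJY u huJ) _ (hΨU v hv b) (hne v hv b u huJ)
        rw [hs, hs]
        intro h
        have h2 : (#(F.neighborFinset v) : ZMod p) * g (Ψ (v, false))
            = (#(F.neighborFinset v) : ZMod p) * g (Ψ (v, true)) := by linear_combination -h
        have h0 : (#(F.neighborFinset v) : ZMod p) ≠ 0 := by
          rw [Ne, ZMod.natCast_eq_zero_iff]
          intro hd
          have h3 := Nat.le_of_dvd (hdeg v hv).1 hd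
          have := (hdeg v hv).2
          omega
        exact hΨ3 v hv (mul_left_cancel₀ h0 h2)
    · push Not at hpairs
      obtain ⟨γ, hγ⟩ := hpairs
      set M2 := M'.filter (fun y => g y = γ) with hM2
      have hM2c : #M2 + #{y ∈ M' | g y ≠ γ} = #M' :=
        Finset.card_filter_add_card_filter_not _
      have hM2U : ∀ x ∈ M2, x ∉ U ∧ g x = γ := by
        intro x hx
        rw [hM2, Finset.mem_filter, hM', Finset.mem_sdiff, hMmem] at hx
        exact ⟨hx.1.1, hx.2⟩
      have hY2 : E < #(M2.filter (fun y => y ∈ Y)) := by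
        have hsub : Y ⊆ M2.filter (fun y => y ∈ Y) ∪ (YJ ∪ {y ∈ M' | g y ≠ γ}) := by
          intro y hy
          simp only [Finset.mem_union, Finset.mem_filter, hM2, hM', Finset.mem_sdiff,
            Finset.mem_univ, true_and]
          have := hYU y hy
          tauto
        have h1 := Finset.card_le_card hsub
        have h2 := Finset.card_union_le (M2.filter (fun y => y ∈ Y)) (YJ ∪ {y ∈ M' | g y ≠ γ})
        have h3 := Finset.card_union_le YJ {y ∈ M' | g y ≠ γ}
        omega
      have hYrow : ∀ y ∈ Y, y ∈ M2 → ∀ z ∈ M2, z ≠ y → χ y z = c - γ - γ := by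
        intro y hy hy2 z hz hzy
        rw [hc y hy z (hM2U z hz).1 hzy, (hM2U y hy2).2, (hM2U z hz).2]
      refine zs_mono_greedy F hF χ hsym hdiv (by omega) M2 (c - γ - γ) E (by omega) ?_
      intro x hx
      by_cases hxY : x ∈ Y
      · rw [Finset.filter_false_of_mem]
        · simp
        · intro y hy h
          exact h.2 (hYrow x hxY hx y hy h.1)
      · rcases hrow x (hM2U x hx).1 with h | ⟨k, hk⟩
        · exact absurd (Finset.mem_filter.2 ⟨(hMmem x).2 (hM2U x hx).1, h⟩) hxY
        · obtain ⟨y, hy, hyk⟩ : ∃ y ∈ M2.filter (fun y => y ∈ Y), χ x y = k := by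
            by_contra! hcon
            have : M2.filter (fun y => y ∈ Y) ⊆
                ({z | z ∉ U ∧ z ≠ x ∧ χ x z ≠ k} : Finset W) := by
              intro y hy
              have h1 := hcon y hy
              rw [Finset.mem_filter] at hy
              simp only [Finset.mem_filter, Finset.mem_univ, true_and]
              exact ⟨(hM2U y hy.1).1, fun h => hxY (h ▸ hy.2), h1⟩
            have := Finset.card_le_card this
            omega
          rw [Finset.mem_filter] at hy
          have hkk : k = c - γ - γ := by
            rw [← hyk, hsym]
            exact hYrow y hy.2 hy.1 x hx (fun h => hxY (h ▸ hy.2))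
          refine (Finset.card_le_card ?_).trans hk
          intro z hz
          rw [Finset.mem_filter] at hz
          simp only [Finset.mem_filter, Finset.mem_univ, true_and]
          rw [hkk]
          exact ⟨(hM2U z hz.1).1, hz.2⟩

lemma zs_select {V : Type*} [DecidableEq V] (d : V → ℕ) (q : ℕ) (hq : 1 ≤ q) (t : ℕ) :
    ∀ A : Finset V, #A = q + t → (∀ v ∈ A, 1 ≤ d v) → ∑ v ∈ A, d v + 1 ≤ 2 * #A →
      ∃ I ⊆ A, #I = q ∧ ∑ v ∈ I, d v + 1 ≤ 2 * q := by
  induction t with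
  | zero =>
    intro A hA hd hs
    exact ⟨A, Finset.Subset.refl _, hA, by rw [hA] at hs; exact hs⟩
  | succ t ih =>
    intro A hA hd hs
    by_cases h : ∃ v ∈ A, 2 ≤ d v
    · obtain ⟨v, hv, hv2⟩ := h
      have h1 := Finset.card_erase_of_mem hv
      have h2 := Finset.add_sum_erase A d hv
      obtain ⟨I, hI, hIq, hIs⟩ := ih (A.erase v) (by omega)
        (fun w hw => hd w (Finset.mem_of_mem_erase hw)) (by omega)
      exact ⟨I, hI.trans (Finset.erase_subset _ _), hIq, hIs⟩
    · push Not at h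
      obtain ⟨I, hI, hIq⟩ := Finset.exists_subset_card_eq (s := A) (n := q) (by omega)
      refine ⟨I, hI, hIq, ?_⟩
      have : ∑ v ∈ I, d v ≤ ∑ _v ∈ I, 1 := by
        apply Finset.sum_le_sum
        intro v hv
        have := h v (hI hv)
        omega
      simp at this
      omega

/-- Edge count of a forest against the non-isolated vertices. -/
lemma zs_edges_lt {V : Type*} [Fintype V] [DecidableEq V]
    (F : SimpleGraph V) [DecidableRel F.Adj] (hF : F.IsAcyclic) (S : Finset V)
    (hS : ∀ v, v ∈ S ↔ 0 < #(F.neighborFinset v)) (hne : S.Nonempty) :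
    #F.edgeFinset + 1 ≤ #S := by
  have h1 := zs_forest_degsum F hF S hne
  have h2 : ∑ x ∈ S, #{y ∈ S | F.Adj x y} = ∑ x, F.degree x := by
    rw [← Finset.sum_subset (Finset.subset_univ S)]
    · apply Finset.sum_congr rfl
      intro x hx
      rw [← SimpleGraph.card_neighborFinset_eq_degree]
      congr 1
      ext y
      simp only [Finset.mem_filter, SimpleGraph.mem_neighborFinset, hS]
      refine ⟨fun h => h.2, fun h => ⟨?_, h⟩⟩
      rw [Finset.card_pos]
      exact ⟨x, by simpa using h.symm⟩
    · intro x _ hx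
      rw [hS, SimpleGraph.card_neighborFinset_eq_degree] at hx
      omega
  rw [h2, SimpleGraph.sum_degrees_eq_twice_card_edges] at h1
  omega

lemma zs_choose {V : Type*} [Fintype V] [DecidableEq V]
    (F : SimpleGraph V) [DecidableRel F.Adj] (hF : F.IsAcyclic) (q : ℕ) (hq : 1 ≤ q)
    (S : Finset V) (hS : ∀ v, v ∈ S ↔ 0 < #(F.neighborFinset v)) (hSq : 2 * q ≤ #S) :
    ∃ J I : Finset V, Disjoint J I ∧ (∀ v ∈ I, ∀ w, F.Adj v w → w ∈ J) ∧
      (∀ v ∈ I, 1 ≤ #(F.neighborFinset v) ∧ #(F.neighborFinset v) ≤ q) ∧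
      #J + 1 ≤ 2 * q ∧ #I = q := by
  have hm := zs_edges_lt F hF S hS (by rw [← Finset.card_pos]; omega)
  obtain ⟨C⟩ := hF.colorable_two
  -- the larger colour class
  obtain ⟨i, hi⟩ : ∃ i : Fin 2, #S ≤ 2 * #{v ∈ S | C v = i} := by
    have h1 : #{v ∈ S | C v = 0} + #{v ∈ S | ¬ C v = 0} = #S :=
      Finset.card_filter_add_card_filter_not _
    have h2 : #{v ∈ S | ¬ C v = 0} ≤ #{v ∈ S | C v = 1} := by
      apply Finset.card_le_card
      intro v hv
      rw [Finset.mem_filter] at hv ⊢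
      refine ⟨hv.1, ?_⟩
      have := hv.2
      generalize C v = c at *
      fin_cases c
      · exact absurd rfl this
      · rfl
    by_cases h : #S ≤ 2 * #{v ∈ S | C v = 0}
    · exact ⟨0, h⟩
    · exact ⟨1, by omega⟩
  set A := {v ∈ S | C v = i} with hA
  have hAi : ∀ u ∈ A, ∀ v ∈ A, ¬ F.Adj u v := by
    intro u hu v hv huv
    rw [hA, Finset.mem_filter] at hu hv
    exact C.valid huv (hu.2.trans hv.2.symm)
  have hsum : ∑ v ∈ A, #(F.neighborFinset v) ≤ #F.edgeFinset := by
    have := zs_edge_split F A hAi (fun _ => 1)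
    simp only [Finset.sum_const, smul_eq_mul, mul_one] at this
    omega
  obtain ⟨I, hIA, hIq, hIs⟩ := zs_select (fun v => #(F.neighborFinset v)) q hq (#A - q) A
    (by omega) (fun v hv => (hS v).1 (Finset.mem_filter.1 hv).1) (by omega)
  have hpos : ∀ v ∈ I, 1 ≤ #(F.neighborFinset v) :=
    fun v hv => (hS v).1 (Finset.mem_filter.1 (hIA hv)).1
  refine ⟨I.biUnion (fun v => F.neighborFinset v), I, ?_, ?_, ?_, ?_, hIq⟩
  · rw [Finset.disjoint_left]
    intro w hw hwI
    obtain ⟨v, hv, hvw⟩ := Finset.mem_biUnion.1 hw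
    rw [SimpleGraph.mem_neighborFinset] at hvw
    exact hAi v (hIA hv) w (hIA hwI) hvw
  · intro v hv w hvw
    exact Finset.mem_biUnion.2 ⟨v, hv, by simpa using hvw⟩
  · intro v hv
    refine ⟨hpos v hv, ?_⟩
    have h1 := Finset.add_sum_erase I (fun v => #(F.neighborFinset v)) hv
    have h2 : ∑ _w ∈ I.erase v, 1 ≤ ∑ w ∈ I.erase v, #(F.neighborFinset w) :=
      Finset.sum_le_sum (fun w hw => hpos w (Finset.mem_of_mem_erase hw))
    have h3 := Finset.card_erase_of_mem hv
    rw [Finset.sum_const, smul_eq_mul, mul_one] at h2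
    omega
  · have := Finset.card_biUnion_le (s := I) (t := fun v => F.neighborFinset v)
    omega

lemma zs_leaves {V W : Type*} [DecidableEq V] [DecidableEq W] (T : Finset V) (f0 : V → W)
    (hinj : Set.InjOn f0 T) (b : V → V) (cand : V → Finset W) (N : ℕ) (Q : Finset V) :
    Set.InjOn b Q → (∀ a ∈ Q, b a ∉ T) → #T + #Q ≤ N → (∀ a ∈ Q, N ≤ #(cand a)) →
    ∃ f : V → W, Set.InjOn f (T ∪ Q.image b : Finset V) ∧ (∀ v ∈ T, f v = f0 v) ∧
      ∀ a ∈ Q, f (b a) ∈ cand a := by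
  induction Q using Finset.induction_on with
  | empty =>
    intro _ _ _ _
    exact ⟨f0, by simpa using hinj, fun _ _ => rfl, fun a ha => absurd ha (Finset.notMem_empty _)⟩
  | insert a Q ha ih =>
    intro hb hbT hc hN
    rw [Finset.card_insert_of_notMem ha] at hc
    obtain ⟨f, hf, hfT, hfc⟩ := ih (hb.mono (by simp))
      (fun x hx => hbT x (Finset.mem_insert_of_mem hx)) (by omega)
      (fun x hx => hN x (Finset.mem_insert_of_mem hx))
    set X := T ∪ Q.image b with hX
    have hXc : #(X.image f) ≤ #T + #Q := by
      have h1 := Finset.card_image_le (s := X) (f := f)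
      have h2 : #X ≤ #T + #(Q.image b) := Finset.card_union_le T (Q.image b)
      have h3 := Finset.card_image_le (s := Q) (f := b)
      omega
    obtain ⟨y, hy, hyX⟩ := Finset.exists_mem_notMem_of_card_lt_card
      (s := X.image f) (t := cand a) (by
        have := hN a (Finset.mem_insert_self _ _)
        omega)
    have hbX : b a ∉ X := by
      rw [hX, Finset.mem_union, Finset.mem_image]
      rintro (h | ⟨x, hx, hxa⟩)
      · exact hbT a (Finset.mem_insert_self _ _) h
      · have := hb (Finset.mem_coe.2 (Finset.mem_insert_of_mem hx))
          (Finset.mem_coe.2 (Finset.mem_insert_self a Q)) hxa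
        exact ha (this ▸ hx)
    have hup : ∀ x ∈ X, Function.update f (b a) y x = f x := by
      intro x hx
      have hne : x ≠ b a := fun h => hbX (h ▸ hx)
      exact Function.update_of_ne hne _ _
    refine ⟨Function.update f (b a) y, ?_, ?_, ?_⟩
    · have hXe : T ∪ (insert a Q).image b = insert (b a) X := by
        rw [Finset.image_insert, Finset.union_insert]
      rw [hXe]
      intro u hu v hv huv
      rw [Finset.mem_coe, Finset.mem_insert] at hu hv
      rcases hu with rfl | hu <;> rcases hv with rfl | hv
      · rfl
      · rw [Function.update_self, hup v hv] at huv
        exact absurd (Finset.mem_image.2 ⟨v, hv, huv.symm⟩) hyX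
      · rw [Function.update_self, hup u hu] at huv
        exact absurd (Finset.mem_image.2 ⟨u, hu, huv⟩) hyX
      · rw [hup u hu, hup v hv] at huv
        exact hf hu hv huv
    · intro v hv
      rw [hup v (Finset.mem_union_left _ hv), hfT v hv]
    · intro x hx
      rcases Finset.mem_insert.1 hx with rfl | hx
      · rw [Function.update_self]; exact hy
      · rw [hup _ (Finset.mem_union_right _ (Finset.mem_image_of_mem _ hx))]
        exact hfc x hx

lemma zs_degsum_sdiff {W : Type*} [Fintype W] [DecidableEq W]
    (R : W → W → Prop) [DecidableRel R] (hsym : ∀ x y, R x y → R y x) (hirr : ∀ x, ¬ R x x)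
    (H : Finset W) :
    ∑ x, #{y | R x y} ≤ ∑ x ∈ Finset.univ \ H, #{y ∈ Finset.univ \ H | R x y}
      + 2 * #H * Fintype.card W := by
  induction H using Finset.induction_on with
  | empty => simp
  | insert h H hh ih =>
    have h1 := zs_degsum_erase R hsym hirr (Finset.univ \ H) h (by simp [hh])
    have h2 : #{y ∈ Finset.univ \ H | R h y} ≤ Fintype.card W := Finset.card_le_univ _
    have h3 : Finset.univ \ insert h H = (Finset.univ \ H).erase h := by
      ext x; simp
    rw [h3, Finset.card_insert_of_notMem hh]
    nlinarith

/-- Many isolated edges in a forest with many vertices compared to edges. -/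
lemma zs_k2 {V : Type*} [Fintype V] [DecidableEq V]
    (F : SimpleGraph V) [DecidableRel F.Adj] (hF : F.IsAcyclic)
    (S : Finset V) (hS : ∀ v, v ∈ S ↔ 0 < #(F.neighborFinset v)) :
    ∃ (P : Finset V) (b : V → V), P ⊆ S ∧ Set.InjOn b P ∧ (∀ a ∈ P, b a ∉ P ∧ b a ∈ S) ∧
      (∀ a ∈ P, ∀ v, F.Adj a v ↔ v = b a) ∧ (∀ a ∈ P, ∀ v, F.Adj (b a) v ↔ v = a) ∧
      2 * #S ≤ #P + 3 * #F.edgeFinset := by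
  obtain ⟨C⟩ := hF.colorable_two
  set L : Finset V := {v | #(F.neighborFinset v) = 1} with hL
  set P : Finset V := {v ∈ L | C v = 0 ∧ ∀ w, F.Adj v w → w ∈ L} with hP
  have hLmem : ∀ v, v ∈ L ↔ ∃ w, ∀ x, F.Adj v x ↔ x = w := by
    intro v
    rw [hL, Finset.mem_filter, Finset.card_eq_one]
    simp only [Finset.mem_univ, true_and]
    refine exists_congr fun w => ?_
    rw [Finset.ext_iff]
    simp
  have hex : ∀ v : V, ∃ w, v ∈ L → ∀ x, F.Adj v x ↔ x = w := by
    intro v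
    by_cases h : v ∈ L
    · obtain ⟨w, hw⟩ := (hLmem v).1 h
      exact ⟨w, fun _ => hw⟩
    · exact ⟨v, fun h' => absurd h' h⟩
  choose b hb using hex
  have hPL : ∀ a ∈ P, a ∈ L ∧ C a = 0 ∧ b a ∈ L ∧ F.Adj a (b a) := by
    intro a ha
    rw [hP, Finset.mem_filter] at ha
    have : F.Adj a (b a) := (hb a ha.1 (b a)).2 rfl
    exact ⟨ha.1, ha.2.1, ha.2.2 _ this, this⟩
  have hbb : ∀ a ∈ P, ∀ v, F.Adj (b a) v ↔ v = a := by
    intro a ha v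
    obtain ⟨h1, h2, h3, h4⟩ := hPL a ha
    have h5 : a = b (b a) := (hb (b a) h3 a).1 h4.symm
    rw [hb (b a) h3 v, ← h5]
  have hLS : L ⊆ S := by
    intro v hv
    rw [hL, Finset.mem_filter] at hv
    rw [hS]; omega
  refine ⟨P, b, (Finset.filter_subset _ _).trans hLS, ?_, ?_, ?_, hbb, ?_⟩
  · intro a ha a' ha' h
    have h1 := (hPL a' ha').2.2.2.symm
    rw [← h] at h1
    exact ((hbb a ha a').1 h1).symm
  · intro a ha
    obtain ⟨h1, h2, h3, h4⟩ := hPL a ha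
    refine ⟨fun h => ?_, hLS h3⟩
    exact C.valid h4 (h2.trans (hPL _ h).2.1.symm)
  · intro a ha
    exact hb a (hPL a ha).1
  · -- counting
    have hsum : ∑ v ∈ S, #(F.neighborFinset v) = 2 * #F.edgeFinset := by
      rw [← SimpleGraph.sum_degrees_eq_twice_card_edges]
      apply Finset.sum_subset (Finset.subset_univ S)
      intro x _ hx
      rw [hS] at hx
      omega
    have h1 : 2 * #S ≤ ∑ v ∈ S, #(F.neighborFinset v) + #L := by
      have : ∑ _v ∈ S, 2 ≤ ∑ v ∈ S, (#(F.neighborFinset v) + if v ∈ L then 1 else 0) := by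
        apply Finset.sum_le_sum
        intro v hv
        rw [hS] at hv
        by_cases hvL : v ∈ L
        · rw [if_pos hvL]; omega
        · rw [if_neg hvL]
          have : #(F.neighborFinset v) ≠ 1 := fun h => hvL (by
            rw [hL, Finset.mem_filter]; exact ⟨Finset.mem_univ _, h⟩)
          omega
      rw [Finset.sum_add_distrib, Finset.sum_const, smul_eq_mul, ← Finset.sum_filter,
        ← Finset.card_eq_sum_ones] at this
      have h2 := Finset.card_le_card (s := {v ∈ S | v ∈ L}) (t := L)
        (fun v hv => (Finset.mem_filter.1 hv).2)
      omega
    have h2 : #(L \ P) ≤ #F.edgeFinset := by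
      have hind : ∀ u ∈ L \ P, ∀ v ∈ L \ P, ¬ F.Adj u v := by
        have key : ∀ u ∈ L \ P, ∀ v ∈ L \ P, F.Adj u v → C u ≠ 0 := by
          intro u hu v hv huv hc
          rw [Finset.mem_sdiff] at hu hv
          apply hu.2
          rw [hP, Finset.mem_filter]
          refine ⟨hu.1, hc, fun w hw => ?_⟩
          rw [(hb u hu.1 w).1 hw, ← (hb u hu.1 v).1 huv]
          exact hv.1
        intro u hu v hv huv
        have h3 := key u hu v hv huv
        have h4 := key v hv u hu huv.symm
        have h5 := C.valid huv
        generalize C u = x at *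
        generalize C v = y at *
        omega
      have := zs_edge_split F (L \ P) hind (fun _ => 1)
      simp only [Finset.sum_const, smul_eq_mul, mul_one] at this
      have h6 : ∑ v ∈ L \ P, #(F.neighborFinset v) = ∑ v ∈ L \ P, 1 := by
        apply Finset.sum_congr rfl
        intro v hv
        exact (Finset.mem_filter.1 (Finset.mem_sdiff.1 hv).1).2
      rw [h6, ← Finset.card_eq_sum_ones] at this
      omega
    have h3 := Finset.le_card_sdiff P L
    omega

/-- A popular colour. -/
lemma zs_popular {W : Type*} [Fintype W] [DecidableEq W] {p : ℕ} [Fact p.Prime]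
    (χ : W → W → ZMod p) :
    ∃ k, Fintype.card W * (Fintype.card W - 1) ≤ p * ∑ x, #{y | x ≠ y ∧ χ x y = k} := by
  by_contra! h
  have h1 : ∑ k : ZMod p, p * ∑ x, #{y | x ≠ y ∧ χ x y = k}
      < ∑ _k : ZMod p, Fintype.card W * (Fintype.card W - 1) :=
    Finset.sum_lt_sum_of_nonempty ⟨0, Finset.mem_univ _⟩ (fun k _ => h k)
  rw [← Finset.mul_sum, Finset.sum_comm, Finset.sum_const, Finset.card_univ, ZMod.card,
    smul_eq_mul] at h1
  have h2 : ∀ x : W, ∑ k : ZMod p, #{y | x ≠ y ∧ χ x y = k} = Fintype.card W - 1 := by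
    intro x
    have := Finset.card_eq_sum_card_fiberwise (f := fun y => χ x y) (s := Finset.univ.erase x)
      (t := Finset.univ) (fun _ _ => Finset.mem_coe.2 (Finset.mem_univ _))
    rw [Finset.card_erase_of_mem (Finset.mem_univ _), Finset.card_univ] at this
    rw [this]
    apply Finset.sum_congr rfl
    intro k _
    congr 1
    ext y
    simp [eq_comm]
  simp only [h2, Finset.sum_const, Finset.card_univ, smul_eq_mul] at h1
  exact lt_irrefl _ h1

lemma zs_small {V W : Type*} [Fintype V] [DecidableEq V] [Fintype W] [DecidableEq W]
    (F : SimpleGraph V) [DecidableRel F.Adj] (hF : F.IsAcyclic) {p : ℕ} [Fact p.Prime]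
    (χ : W → W → ZMod p) (hsym : ∀ x y, χ x y = χ y x) (hdiv : p ∣ #F.edgeFinset)
    (hW : 3 * p ^ 2 ≤ Fintype.card W + 3 * p + 1)
    (hVW : Fintype.card V ≤ Fintype.card W)
    (S : Finset V) (hS : ∀ v, v ∈ S ↔ 0 < #(F.neighborFinset v)) (hne : S.Nonempty)
    (hSp : #S + 3 ≤ 2 * p) : ZSCopy F χ hsym := by
  have hm := zs_edges_lt F hF S hS hne
  have hadjS : ∀ u v, F.Adj u v → u ∈ S := by
    intro u v huv
    rw [hS, Finset.card_pos]
    exact ⟨v, by simpa using huv⟩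
  have hmpos : 0 < #F.edgeFinset := by
    obtain ⟨v, hv⟩ := hne
    rw [hS, Finset.card_pos] at hv
    obtain ⟨w, hw⟩ := hv
    rw [SimpleGraph.mem_neighborFinset] at hw
    rw [Finset.card_pos]
    exact ⟨s(v, w), by simpa using hw⟩
  have hmp : #F.edgeFinset = p := by
    obtain ⟨t, ht⟩ := hdiv
    have : t < 2 := by
      by_contra! h
      have := Nat.mul_le_mul_left p h
      omega
    interval_cases t <;> omega
  have hp4 : 4 ≤ p := by omega
  have hWne : Nonempty W := by
    rw [← Fintype.card_pos_iff]
    nlinarith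
  obtain ⟨P, b, hPS, hbinj, hbP, haP, hbP2, hPc⟩ := zs_k2 F hF S hS
  obtain ⟨k, hk⟩ := zs_popular χ
  set N := Fintype.card W with hN
  set j := #S - 3 * p / 2 with hj
  have hjP : j ≤ #P := by omega
  obtain ⟨Q, hQP, hQj⟩ := Finset.exists_subset_card_eq hjP
  let R : W → W → Prop := fun x y => x ≠ y ∧ χ x y = k
  have hRs : ∀ x y, R x y → R y x := fun x y h => ⟨h.1.symm, by rw [hsym]; exact h.2⟩
  have hRi : ∀ x, ¬ R x x := fun x h => h.1 rfl
  haveI : DecidableRel R := fun x y => inferInstanceAs (Decidable (x ≠ y ∧ χ x y = k))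
  have hk' : N * (N - 1) ≤ p * ∑ x, #{y | R x y} := by convert hk
  set D := ∑ x, #{y | R x y} with hD
  obtain ⟨N', hN'⟩ : ∃ N', N = N' + 1 := ⟨N - 1, by
    have : 0 < N := Fintype.card_pos
    omega⟩
  have hNN : N * (N - 1) = N * N' := by rw [hN']; simp
  rw [hNN] at hk'
  have hNpos : 0 < N := by omega
  have hDbig : ∀ c, D ≤ c * N → N' ≤ p * c := by
    intro c hc
    have h1 := Nat.mul_le_mul_left p hc
    have h2 : N * N' ≤ N * (p * c) := by
      calc N * N' ≤ p * D := hk'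
        _ ≤ p * (c * N) := h1
        _ = N * (p * c) := by ring
    exact Nat.le_of_mul_le_mul_left h2 hNpos
  -- high degree vertices
  obtain ⟨H, hH, hHj⟩ : ∃ H : Finset W, (∀ x ∈ H, #S ≤ #{y | R x y}) ∧ #H = j := by
    set H1 : Finset W := {x | #S ≤ #{y | R x y}} with hH1
    by_cases hc : j ≤ #H1
    · obtain ⟨H, hHs, hHc⟩ := Finset.exists_subset_card_eq hc
      exact ⟨H, fun x hx => (Finset.mem_filter.1 (hHs hx)).2, hHc⟩
    · exfalso
      have hb1 : D ≤ ∑ x : W, ((if x ∈ H1 then N else 0) + (#S - 1)) := by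
        rw [hD]
        apply Finset.sum_le_sum
        intro x _
        by_cases hx : x ∈ H1
        · rw [if_pos hx]
          have : #{y | R x y} ≤ N := Finset.card_le_univ _
          omega
        · rw [if_neg hx]
          have : ¬ #S ≤ #{y | R x y} := fun h => hx (Finset.mem_filter.2 ⟨Finset.mem_univ _, h⟩)
          omega
      rw [Finset.sum_add_distrib, Finset.sum_ite_mem, Finset.univ_inter, Finset.sum_const,
        Finset.sum_const, Finset.card_univ, smul_eq_mul, smul_eq_mul] at hb1
      have hb2 : D ≤ (#H1 + (#S - 1)) * N := by
        calc D ≤ _ := hb1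
          _ = _ := by ring
      have hb3 := hDbig _ hb2
      have hb4 : 2 * (#H1 + (#S - 1)) + 13 ≤ 5 * p := by omega
      nlinarith
  -- the core
  obtain ⟨A, hAH, hAne, hAd⟩ := zs_core R hRs hRi (#S - 2 * j - 2) (Finset.univ \ H) (by
    by_contra! hcon
    have h1 := zs_degsum_sdiff R hRs hRi H
    have h2 : #(Finset.univ \ H) ≤ N := Finset.card_le_univ _
    have h3 : 2 * (#S - 2 * j - 2) * #(Finset.univ \ H) ≤ 2 * (#S - 2 * j - 2) * N :=
      Nat.mul_le_mul_left _ h2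
    have h4 : D ≤ (2 * (#S - 2 * j - 2) + 2 * j) * N := by
      rw [hHj, ← hN] at h1
      calc D ≤ _ := h1
        _ ≤ 2 * (#S - 2 * j - 2) * N + 2 * j * N := by
          have := hcon.trans h3
          omega
        _ = _ := by ring
    have h5 := hDbig _ h4
    have h6 : 2 * (#S - 2 * j - 2) + 2 * j + 4 ≤ 3 * p := by omega
    nlinarith)
  set Qb := Q.image b with hQb
  have hQbc : #Qb = j := by
    rw [hQb, Finset.card_image_of_injOn (hbinj.mono (by exact_mod_cast hQP)), hQj]
  have hdQ : Disjoint Q Qb := by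
    rw [Finset.disjoint_left]
    intro a ha ha'
    obtain ⟨a2, ha2, rfl⟩ := Finset.mem_image.1 ha'
    exact (hbP a2 (hQP ha2)).1 (hQP ha)
  have hQQbS : Q ∪ Qb ⊆ S := by
    intro v hv
    rcases Finset.mem_union.1 hv with h | h
    · exact hPS (hQP h)
    · obtain ⟨a, ha, rfl⟩ := Finset.mem_image.1 h
      exact (hbP a (hQP ha)).2
  set S1 := S \ (Q ∪ Qb) with hS1
  have hS1c : #S1 = #S - 2 * j := by
    rw [hS1, Finset.card_sdiff_of_subset hQQbS, Finset.card_union_of_disjoint hdQ]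
    omega
  have hAdeg : ∀ x ∈ A, #S1 ≤ #{y ∈ A | R x y} + 1 := by
    intro x hx
    have := hAd x hx
    omega
  obtain ⟨f1, hf1, hf1A, hf1R⟩ := zs_greedy F hF R hRs hRi A S1 (by
    obtain ⟨x, hx⟩ := hAne
    have h1 := hAdeg x hx
    have h2 : {y ∈ A | R x y} ⊂ A := by
      rw [Finset.filter_ssubset]
      exact ⟨x, hx, hRi x⟩
    have := Finset.card_lt_card h2
    omega) hAdeg
  obtain ⟨h, hh, hhH⟩ := zs_inj Q H (by omega)
  let f0 : V → W := fun v => if v ∈ Q then h v else f1 v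
  have e1 : ∀ v ∈ Q, f0 v = h v := by intro v hv; simp [f0, hv]
  have hS1Q : ∀ v ∈ S1, v ∉ Q ∧ v ∉ Qb := by
    intro v hv
    rw [hS1, Finset.mem_sdiff, Finset.mem_union] at hv
    tauto
  have e2 : ∀ v ∈ S1, f0 v = f1 v := by intro v hv; simp [f0, (hS1Q v hv).1]
  have hsep : ∀ u ∈ S1, ∀ v ∈ Q, f1 u ≠ h v := by
    intro u hu v hv huv
    have h1 := hAH (hf1A u hu)
    rw [huv, Finset.mem_sdiff] at h1
    exact h1.2 (hhH v hv)
  have hf0 : Set.InjOn f0 (S1 ∪ Q : Finset V) := by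
    intro u hu v hv huv
    rw [Finset.mem_coe, Finset.mem_union] at hu hv
    rcases hu with hu | hu <;> rcases hv with hv | hv
    · rw [e2 u hu, e2 v hv] at huv; exact hf1 hu hv huv
    · rw [e2 u hu, e1 v hv] at huv; exact absurd huv (hsep u hu v hv)
    · rw [e1 u hu, e2 v hv] at huv; exact absurd huv.symm (hsep v hv u hu)
    · rw [e1 u hu, e1 v hv] at huv; exact hh hu hv huv
  obtain ⟨f, hf, hff0, hfc⟩ := zs_leaves (S1 ∪ Q) f0 hf0 b (fun a => {y | R (h a) y}) #S Q
    (hbinj.mono (by exact_mod_cast hQP))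
    (by
      intro a ha hmem
      have hb1 : b a ∈ Qb := Finset.mem_image_of_mem _ ha
      rcases Finset.mem_union.1 hmem with h1 | h1
      · exact (hS1Q _ h1).2 hb1
      · exact Finset.disjoint_left.1 hdQ h1 hb1)
    (by
      have := Finset.card_union_le S1 Q
      omega)
    (fun a ha => hH _ (hhH a ha))
  have hSeq : S1 ∪ Q ∪ Q.image b = S := by
    rw [Finset.union_assoc, ← hQb, hS1]
    exact Finset.sdiff_union_of_subset hQQbS
  rw [hSeq] at hf
  have hQedge : ∀ a ∈ Q, χ (f a) (f (b a)) = k := by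
    intro a ha
    have h1 := hfc a ha
    rw [Finset.mem_filter] at h1
    rw [hff0 a (Finset.mem_union_right _ ha), e1 a ha]
    exact h1.2.2
  refine zs_mono F χ hsym hdiv hVW S hadjS f hf k ?_
  intro u hu v hv huv
  by_cases h1 : u ∈ Q
  · rw [(haP u (hQP h1) v).1 huv]
    exact hQedge u h1
  by_cases h2 : v ∈ Q
  · rw [(haP v (hQP h2) u).1 huv.symm, hsym]
    exact hQedge v h2
  by_cases h3 : u ∈ Qb
  · obtain ⟨a, ha, rfl⟩ := Finset.mem_image.1 h3
    exact absurd ((hbP2 a (hQP ha) v).1 huv ▸ ha) h2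
  by_cases h4 : v ∈ Qb
  · obtain ⟨a, ha, rfl⟩ := Finset.mem_image.1 h4
    exact absurd ((hbP2 a (hQP ha) u).1 huv.symm ▸ ha) h1
  have hu1 : u ∈ S1 := by rw [hS1, Finset.mem_sdiff, Finset.mem_union]; tauto
  have hv1 : v ∈ S1 := by rw [hS1, Finset.mem_sdiff, Finset.mem_union]; tauto
  rw [hff0 u (Finset.mem_union_left _ hu1), hff0 v (Finset.mem_union_left _ hv1),
    e2 u hu1, e2 v hv1]
  exact (hf1R u hu1 v hv1 huv).2

/-- Main theorem: for every prime `p` and every forest `F` on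
`n ≥ 3p² − 12p + 11` vertices with `p ∣ e(F)`, every `ZMod p`-edge-coloring of the
complete graph on `n + 9p − 12` vertices contains a zero-sum copy of `F`; that is,
`R(F, ℤ_p) ≤ n + 9p − 12`. -/
theorem zero_sum_ramsey_forest (p : ℕ) (hp : p.Prime) (n : ℕ)
    (hn : 3 * p ^ 2 - 12 * p + 11 ≤ n)
    (V : Type*) [Fintype V] [DecidableEq V] (F : SimpleGraph V) [DecidableRel F.Adj]
    (hforest : F.IsAcyclic) (hcard : Fintype.card V = n)
    (hdiv : p ∣ F.edgeFinset.card)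
    (χ : Fin (n + 9 * p - 12) → Fin (n + 9 * p - 12) → ZMod p)
    (hsym : ∀ x y, χ x y = χ y x) :
    ∃ f : V ↪ Fin (n + 9 * p - 12),
      ∑ e ∈ F.edgeFinset,
        Sym2.lift ⟨fun x y => χ (f x) (f y), fun x y => hsym (f x) (f y)⟩ e = 0 := by
  haveI : Fact p.Prime := ⟨hp⟩
  obtain ⟨q, rfl⟩ : ∃ q, p = q + 1 := ⟨p - 1, by have := hp.two_le; omega⟩
  have hq : 1 ≤ q := by have := hp.two_le; omega
  have hn1 : 3 * (q + 1) ^ 2 + 11 ≤ n + 12 * (q + 1) := by omega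
  have hexp : 3 * (q + 1) ^ 2 = 3 * q ^ 2 + 6 * q + 3 := by ring
  have hW : Fintype.card (Fin (n + 9 * (q + 1) - 12)) = n + 9 * (q + 1) - 12 := Fintype.card_fin _
  have main : ZSCopy F χ hsym := by
    let S : Finset V := {v | 0 < #(F.neighborFinset v)}
    have hS : ∀ v, v ∈ S ↔ 0 < #(F.neighborFinset v) := by
      intro v
      exact ⟨fun h => (Finset.mem_filter.1 h).2, fun h => Finset.mem_filter.2 ⟨Finset.mem_univ _, h⟩⟩
    by_cases hne : S.Nonempty
    · by_cases hc : 2 * q ≤ #S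
      · obtain ⟨J, I, hJI, hN, hdeg, hJ, hI⟩ := zs_choose F hforest q hq S hS hc
        have hnb : ∀ v ∈ I, ∃ w, F.Adj v w := by
          intro v hv
          obtain ⟨w, hw⟩ := Finset.card_pos.1 (hdeg v hv).1
          exact ⟨w, by simpa using hw⟩
        rcases zs_chain F hforest χ q rfl (by rw [hW]; omega) #J J I rfl hJI hN hnb hJ hI.le
          with ⟨Φ, hΦ⟩ | hbad
        · exact zs_switch F χ hsym J I hJI hN (by omega) (by rw [hW]; omega) Φ hΦ
        · exact zs_bad F hforest χ hsym hdiv q rfl (by rw [hW]; omega) (by rw [hW]; omega)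
            J I hJI hN hdeg hJ hI hbad
      · exact zs_small F hforest χ hsym hdiv (by rw [hW]; omega) (by rw [hW]; omega) S hS hne
          (by omega)
    · haveI : Nonempty (Fin (n + 9 * (q + 1) - 12)) := by
        rw [← Fintype.card_pos_iff, hW]; omega
      refine zs_mono F χ hsym hdiv (by rw [hW]; omega) ∅ ?_ (fun _ => Classical.arbitrary _)
        (by simp) 0 (fun u hu => absurd hu (Finset.notMem_empty _))
      intro u v huv
      exfalso
      apply hne
      exact ⟨u, (hS u).2 (Finset.card_pos.2 ⟨v, by simpa using huv⟩)⟩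
  obtain ⟨f, hf, hsum⟩ := main
  exact ⟨⟨f, hf⟩, hsum⟩
end
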